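/- arXiv:1408.1478 — 3 statements merged into one kernel-verified Lean document; each statement's English description precedes it below -/
import Mathlib

section
/- Fix n ≥ 1 and b with 0 < b < 1. Let u be a tempered distribution on ℝⁿ and (x₀, ξ₀) ∈ ℝⁿ × (ℝⁿ \ {0}). The following three conditions are equivalent. (i) (x₀, ξ₀) ∉ WF(u). (ii) There exist φ ∈ 𝒮(ℝⁿ) \ {0} and a conic neighborhood K × Γ of (x₀, ξ₀) such that for every N ∈ ℕ and every a ≥ 1 there is C_{N,a} > 0 with |W_{φ_λ} u(x, λξ)| ≤ C_{N,a} λ^{−N} for all λ ≥ 1 and all (x, ξ) ∈ K × Γ with a^{−1} ≤ |ξ| ≤ a. (iii) There exists a conic neighborhood K × Γ of (x₀, ξ₀) such that for every φ ∈ 𝒮(ℝⁿ) \ {0}, every N ∈ ℕ and every a ≥ 1 there is C_{N,a,φ} > 0 with |W_{φ_λ} u(x, λξ)| ≤ C_{N,a,φ} λ^{−N} for all λ ≥ 1 and all (x, ξ) ∈ K × Γ with a^{−1} ≤ |ξ| ≤ a. Here φ_λ(x) = λ^{nb/2} φ(λ^b x). -/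
open MeasureTheory Complex
open scoped InnerProductSpace BigOperators

noncomputable section

/-- `ℝⁿ` as a Euclidean space. -/
abbrev Euc (n : ℕ) := EuclideanSpace ℝ (Fin n)

variable {n : ℕ}

/-- Wave packet transform `W_φ f (x, ξ) = ∫ conj (φ (y - x)) f y e^{-i y·ξ} dy`. -/
def WPT (φ f : Euc n → ℂ) (x ξ : Euc n) : ℂ :=
  ∫ y, (starRingEnd ℂ) (φ (y - x)) * f y * Complex.exp (-Complex.I * ((⟪y, ξ⟫_ℝ : ℝ) : ℂ))

/-- Fourier transform `f̂(ξ) = ∫ e^{-i y·ξ} f y dy`. -/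
def FT (f : Euc n → ℂ) (ξ : Euc n) : ℂ :=
  ∫ y, Complex.exp (-Complex.I * ((⟪y, ξ⟫_ℝ : ℝ) : ℂ)) * f y

/-- Free Schrödinger evolution `U₀(t) f (x) = (2π)^{-n} ∫ e^{i(x·ξ - t|ξ|²/2)} f̂(ξ) dξ`. -/
def U0 (t : ℝ) (f : Euc n → ℂ) (x : Euc n) : ℂ :=
  (((2 * Real.pi) ^ n)⁻¹ : ℝ) •
    ∫ ξ, Complex.exp (Complex.I * ((⟪x, ξ⟫_ℝ - t * ‖ξ‖ ^ 2 / 2 : ℝ) : ℂ)) * FT f ξ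

/-- Dilation `(φ)_λ(x) = λ^{n b / 2} φ (λ^b x)` (with `λ^b` a real power). -/
def dilate (b lam : ℝ) (φ : Euc n → ℂ) : Euc n → ℂ :=
  fun x => ((lam ^ ((n : ℝ) * b / 2) : ℝ) : ℂ) * φ ((lam ^ b : ℝ) • x)

/-- `V` is smooth and sub-quadratic with exponent `ρ`:
`|∂_x^α V(t,x)| ≤ C_α (1+|x|)^{ρ-|α|}` for all multi-indices `α`. -/
def SubQuadratic (ρ : ℝ) (V : ℝ × Euc n → ℝ) : Prop :=
  ContDiff ℝ (⊤ : ℕ∞) V ∧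
    ∀ k : ℕ, ∃ C : ℝ, 0 < C ∧ ∀ (t : ℝ) (x : Euc n),
      ‖iteratedFDeriv ℝ k (fun z => V (t, z)) x‖ ≤ C * (1 + ‖x‖) ^ (ρ - (k : ℝ))

/-- Gradient of `V` in the `x` variable. -/
def gradV (V : ℝ × Euc n → ℝ) (t : ℝ) (x : Euc n) : Euc n :=
  gradient (fun z => V (t, z)) x

/-- `(X, Ξ)` solves the Hamilton equations `ẋ = ξ`, `ξ̇ = -∇ₓ V`. -/
def IsHamiltonSol (V : ℝ × Euc n → ℝ) (X Ξ : ℝ → Euc n) : Prop :=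
  (∀ s, HasDerivAt X (Ξ s) s) ∧ (∀ s, HasDerivAt Ξ (-gradV V s (X s)) s)

/-- `Γ` is a conic neighborhood of `ξ₀`. -/
def IsConicNbhd (Γ : Set (Euc n)) (ξ₀ : Euc n) : Prop :=
  Γ ∈ nhds ξ₀ ∧ ∀ ξ ∈ Γ, ∀ c : ℝ, 0 < c → c • ξ ∈ Γ

/-- `(x₀, ξ₀)` is not in the wave front set of the (locally integrable) function `f`. -/
def NotInWF (f : Euc n → ℂ) (x₀ ξ₀ : Euc n) : Prop :=
  ∃ χ : Euc n → ℝ, ContDiff ℝ (⊤ : ℕ∞) χ ∧ HasCompactSupport χ ∧ χ x₀ ≠ 0 ∧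
    ∃ Γ₀ : Set (Euc n), IsConicNbhd Γ₀ ξ₀ ∧
      ∀ N : ℕ, ∃ C : ℝ, 0 < C ∧ ∀ ξ ∈ Γ₀,
        ‖∫ y, (χ y : ℂ) * f y * Complex.exp (-Complex.I * ((⟪y, ξ⟫_ℝ : ℝ) : ℂ))‖ ≤
          C * (1 + ‖ξ‖) ^ (-(N : ℝ))

/-- `∂_t Φ` for `Φ : ℝ × ℝⁿ → ℂ`. -/
def tDerivP (Φ : ℝ × Euc n → ℂ) (p : ℝ × Euc n) : ℂ :=
  fderiv ℝ Φ p ((1 : ℝ), (0 : Euc n))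

/-- `∂_{x_j} Φ` for `Φ : ℝ × ℝⁿ → ℂ`. -/
def xPartialP (j : Fin n) (Φ : ℝ × Euc n → ℂ) (p : ℝ × Euc n) : ℂ :=
  fderiv ℝ (fun z => Φ (p.1, z)) p.2 (EuclideanSpace.single j 1)

/-- Laplacian in the `x` variable of `Φ : ℝ × ℝⁿ → ℂ`. -/
def xLaplacianP (Φ : ℝ × Euc n → ℂ) (p : ℝ × Euc n) : ℂ :=
  ∑ j : Fin n, xPartialP j (fun q => xPartialP j Φ q) p

/-- `u` is a distributional solution of `i ∂_t u + (1/2) Δ u - V u = 0`: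
`∬ u (−i∂_tΦ + (1/2)ΔΦ − VΦ) dx dt = 0` for every test function `Φ`. -/
def IsDistSol (V : ℝ × Euc n → ℝ) (u : ℝ → Euc n → ℂ) : Prop :=
  ∀ Φ : ℝ × Euc n → ℂ, ContDiff ℝ (⊤ : ℕ∞) Φ → HasCompactSupport Φ →
    (∫ p : ℝ × Euc n, u p.1 p.2 *
        (-Complex.I * tDerivP Φ p + (1 / 2 : ℂ) * xLaplacianP Φ p - ((V p : ℝ) : ℂ) * Φ p)) = 0

/-- `∂_{y_j} g` for `g : ℝⁿ → ℂ`. -/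
def partialD (j : Fin n) (g : Euc n → ℂ) : Euc n → ℂ :=
  fun y => fderiv ℝ g y (EuclideanSpace.single j 1)

/-- Laplacian of `g : ℝⁿ → ℂ`. -/
def lapl (g : Euc n → ℂ) : Euc n → ℂ :=
  fun y => ∑ j : Fin n, partialD j (partialD j g) y

/-- Multi-index derivative `∂^α g`. -/
def multiPartial (α : Fin n → ℕ) (g : Euc n → ℂ) : Euc n → ℂ :=
  ((List.ofFn fun j : Fin n => (partialD j)^[α j]).foldr (· ∘ ·) id) g


open scoped Classical in
/-- Pairing of a tempered distribution with a function of Schwartz class: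
if `f` coincides with (the coercion of) some Schwartz function, the pairing is the
value of the distribution there, and `0` otherwise. -/
def pairing (u : SchwartzMap (Euc n) ℂ →L[ℂ] ℂ) (f : Euc n → ℂ) : ℂ :=
  if h : ∃ ψ : SchwartzMap (Euc n) ℂ, (⇑ψ : Euc n → ℂ) = f then u h.choose else 0

/-- Wave packet transform of a tempered distribution `u` with window `φ`:
`W_φ u (x, ξ) = ⟨u, y ↦ conj (φ (y - x)) e^{-i y·ξ}⟩`. -/
def WPTdist (u : SchwartzMap (Euc n) ℂ →L[ℂ] ℂ) (φ : Euc n → ℂ) (x ξ : Euc n) : ℂ :=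
  pairing u fun y =>
    (starRingEnd ℂ) (φ (y - x)) * Complex.exp (-Complex.I * ((⟪y, ξ⟫_ℝ : ℝ) : ℂ))

/-- `(x₀, ξ₀)` is not in the wave front set of the tempered distribution `u`. -/
def NotInWFdist (u : SchwartzMap (Euc n) ℂ →L[ℂ] ℂ) (x₀ ξ₀ : Euc n) : Prop :=
  ∃ χ : Euc n → ℝ, ContDiff ℝ (⊤ : ℕ∞) χ ∧ HasCompactSupport χ ∧ χ x₀ ≠ 0 ∧
    ∃ Γ₀ : Set (Euc n), IsConicNbhd Γ₀ ξ₀ ∧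
      ∀ N : ℕ, ∃ C : ℝ, 0 < C ∧ ∀ ξ ∈ Γ₀,
        ‖pairing u fun y => ((χ y : ℝ) : ℂ) *
            Complex.exp (-Complex.I * ((⟪y, ξ⟫_ℝ : ℝ) : ℂ))‖ ≤
          C * (1 + ‖ξ‖) ^ (-(N : ℝ))

open scoped SchwartzMap BoundedContinuousFunction

section Integral

variable {E : Type*} [NormedAddCommGroup E] [NormedSpace ℝ E]
  {Z : Type*} [TopologicalSpace Z] [MeasurableSpace Z] {μ : Measure Z}

/-- Continuous multilinear maps in `l` variables, the space of `l`-th derivatives. -/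
def Jet (E : Type*) [NormedAddCommGroup E] [NormedSpace ℝ E] (l : ℕ) : Type _ :=
  ContinuousMultilinearMap ℝ (fun _ : Fin l => E) ℂ

instance (l : ℕ) : NormedAddCommGroup (Jet E l) :=
  inferInstanceAs (NormedAddCommGroup (ContinuousMultilinearMap ℝ (fun _ : Fin l => E) ℂ))

instance (l : ℕ) : NormedSpace ℝ (Jet E l) :=
  inferInstanceAs (NormedSpace ℝ (ContinuousMultilinearMap ℝ (fun _ : Fin l => E) ℂ))

instance (l : ℕ) : NormedSpace ℂ (Jet E l) :=
  inferInstanceAs (NormedSpace ℂ (ContinuousMultilinearMap ℝ (fun _ : Fin l => E) ℂ))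

instance (l : ℕ) : SMulCommClass ℝ ℂ (Jet E l) :=
  inferInstanceAs (SMulCommClass ℝ ℂ (ContinuousMultilinearMap ℝ (fun _ : Fin l => E) ℂ))

instance (l : ℕ) : CompleteSpace (Jet E l) :=
  inferInstanceAs (CompleteSpace (ContinuousMultilinearMap ℝ (fun _ : Fin l => E) ℂ))

/-- The `l`-th derivative at a point, as an element of `Jet E l`. -/
def jet (l : ℕ) (f : E → ℂ) (x : E) : Jet E l := iteratedFDeriv ℝ l f x

/-- The isometry between functions and their jets of order zero. -/
def jetZeroEquiv : ℂ ≃ₗᵢ[ℝ] Jet E 0 := (continuousMultilinearCurryFin0 ℝ E ℂ).symm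

/-- The isometry between derivatives of `l`-jets and `(l + 1)`-jets. -/
def jetSuccEquiv (l : ℕ) : (E →L[ℝ] Jet E l) ≃ₗᵢ[ℝ] Jet E (l + 1) :=
  (continuousMultilinearCurryLeftEquiv ℝ (fun _ : Fin (l + 1) => E) ℂ).symm

lemma jet_zero (f : E → ℂ) (x : E) : jet 0 f x = jetZeroEquiv (f x) := rfl

lemma jet_succ (l : ℕ) (f : E → ℂ) (x : E) :
    jet (l + 1) f x = jetSuccEquiv l (fderiv ℝ (jet l f) x) := rfl

lemma continuous_jet (l : ℕ) (f : 𝓢(E, ℂ)) : Continuous (jet l f) :=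
  (f.smooth l).continuous_iteratedFDeriv le_rfl

lemma norm_jet_le (l : ℕ) (f : 𝓢(E, ℂ)) (x : E) :
    ‖jet l f x‖ ≤ SchwartzMap.seminorm ℂ 0 l f :=
  f.norm_iteratedFDeriv_le_seminorm ℂ l x

lemma norm_pow_smul_jet_le (k l : ℕ) (f : 𝓢(E, ℂ)) (x : E) :
    ‖(‖x‖ ^ k : ℝ) • jet l f x‖ ≤ SchwartzMap.seminorm ℂ k l f := by
  rw [norm_smul, Real.norm_of_nonneg (by positivity)]
  exact f.le_seminorm ℂ k l x

lemma differentiable_jet (l : ℕ) (f : 𝓢(E, ℂ)) : Differentiable ℝ (jet l f) :=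
  (f.smooth (l + 1 : ℕ)).differentiable_iteratedFDeriv (by exact_mod_cast l.lt_succ_self)

lemma jet_add (l : ℕ) (f g : 𝓢(E, ℂ)) (x : E) : jet l ⇑(f + g) x = jet l f x + jet l g x :=
  iteratedFDeriv_add_apply (f.smooth l).contDiffAt (g.smooth l).contDiffAt

lemma jet_smul (l : ℕ) (a : ℂ) (f : 𝓢(E, ℂ)) (x : E) : jet l ⇑(a • f) x = a • jet l f x :=
  iteratedFDeriv_const_smul_apply (f.smooth l).contDiffAt

/-- The weighted derivative `x ↦ ‖x‖ ^ k • Dˡ f(x)` of a Schwartz function, as a bounded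
continuous function depending continuously on `f`. -/
def weightedJet (k l : ℕ) : 𝓢(E, ℂ) →L[ℂ] (E →ᵇ Jet E l) :=
  SchwartzMap.mkCLMtoNormedSpace
    (fun f : 𝓢(E, ℂ) => BoundedContinuousFunction.ofNormedAddCommGroup
      (fun x => (‖x‖ ^ k : ℝ) • jet l f x) ((continuous_norm.pow k).smul (continuous_jet l f))
      (SchwartzMap.seminorm ℂ k l f) (norm_pow_smul_jet_le k l f))
    (fun f g => by
      ext1 x
      simp only [BoundedContinuousFunction.coe_ofNormedAddCommGroup,
        BoundedContinuousFunction.coe_add, Pi.add_apply, ← smul_add, jet_add])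
    (fun a f => by
      ext1 x
      simp only [BoundedContinuousFunction.coe_ofNormedAddCommGroup,
        BoundedContinuousFunction.coe_smul, RingHom.id_apply, jet_smul, smul_comm a])
    ⟨{(k, l)}, 1, zero_le_one, fun f => by
      rw [one_mul, Finset.sup_singleton]
      exact BoundedContinuousFunction.norm_ofNormedAddCommGroup_le _
        (apply_nonneg (SchwartzMap.seminorm ℂ k l) f) (norm_pow_smul_jet_le k l f)⟩

lemma weightedJet_apply (k l : ℕ) (f : 𝓢(E, ℂ)) (x : E) :
    weightedJet k l f x = (‖x‖ ^ k : ℝ) • jet l f x := rfl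

lemma seminorm_le_norm_weightedJet (k l : ℕ) (f : 𝓢(E, ℂ)) :
    SchwartzMap.seminorm ℂ k l f ≤ ‖weightedJet k l f‖ := by
  refine SchwartzMap.seminorm_le_bound ℂ k l f (norm_nonneg _) fun x => ?_
  have := (weightedJet k l f).norm_coe_le_norm x
  rwa [weightedJet_apply, norm_smul, Real.norm_of_nonneg (by positivity)] at this

lemma norm_weightedJet_le (k l : ℕ) (f : 𝓢(E, ℂ)) :
    ‖weightedJet k l f‖ ≤ SchwartzMap.seminorm ℂ k l f :=
  BoundedContinuousFunction.norm_ofNormedAddCommGroup_le _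
    (apply_nonneg (SchwartzMap.seminorm ℂ k l) f) (norm_pow_smul_jet_le k l f)

lemma continuous_jet_apply (l : ℕ) (x : E) : Continuous fun f : 𝓢(E, ℂ) => jet l f x := by
  have h : Continuous fun f : 𝓢(E, ℂ) => weightedJet 0 l f x :=
    (BoundedContinuousFunction.evalCLM ℝ x).continuous.comp (weightedJet 0 l).continuous
  simpa [weightedJet_apply] using h

lemma integrable_jet_apply [OpensMeasurableSpace Z] [SecondCountableTopology Z]
    {F : Z → 𝓢(E, ℂ)} (hF : Continuous F)
    (hint : ∀ k l, Integrable (fun z => SchwartzMap.seminorm ℂ k l (F z)) μ) (l : ℕ) (x : E) :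
    Integrable (fun z => jet l (F z) x) μ :=
  (hint 0 l).mono' ((continuous_jet_apply l x).comp hF).aestronglyMeasurable
    (Filter.Eventually.of_forall fun z => norm_jet_le l (F z) x)

lemma jet_integral [OpensMeasurableSpace Z] [SecondCountableTopology Z]
    {F : Z → 𝓢(E, ℂ)} (hF : Continuous F)
    (hint : ∀ k l, Integrable (fun z => SchwartzMap.seminorm ℂ k l (F z)) μ)
    {f : E → ℂ} (hf : ∀ x, f x = ∫ z, F z x ∂μ) (l : ℕ) (x : E) :
    jet l f x = ∫ z, jet l (F z) x ∂μ := by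
  induction l generalizing x with
  | zero =>
    simp only [jet_zero, hf]
    exact (jetZeroEquiv.toContinuousLinearEquiv.integral_comp_comm fun z => F z x).symm
  | succ l ih =>
    have hl : jet l f = fun x => ∫ z, jet l (F z) x ∂μ := funext ih
    have hsucc (z : Z) (x : E) :
        fderiv ℝ (jet l (F z)) x = (jetSuccEquiv l).symm (jet (l + 1) (F z) x) := by
      rw [jet_succ, LinearIsometryEquiv.symm_apply_apply]
    have hd : HasFDerivAt (jet l f) (∫ z, fderiv ℝ (jet l (F z)) x ∂μ) x := by
      rw [hl]
      refine hasFDerivAt_integral_of_dominated_of_fderiv_le (𝕜 := ℝ) Filter.univ_mem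
        (F' := fun x z => fderiv ℝ (jet l (F z)) x)
        (Filter.Eventually.of_forall fun x =>
          (integrable_jet_apply hF hint l x).aestronglyMeasurable)
        (integrable_jet_apply hF hint l x) ?_
        (bound := fun z => SchwartzMap.seminorm ℂ 0 (l + 1) (F z)) ?_ (hint 0 (l + 1)) ?_
      · simp only [hsucc]
        exact ((jetSuccEquiv l).symm.continuous.comp
          ((continuous_jet_apply (l + 1) x).comp hF)).aestronglyMeasurable
      · refine Filter.Eventually.of_forall fun z x _ => ?_
        rw [hsucc, LinearIsometryEquiv.norm_map]
        exact norm_jet_le (l + 1) (F z) x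
      · exact Filter.Eventually.of_forall fun z x _ => (differentiable_jet l (F z) x).hasFDerivAt
    rw [jet_succ, hd.fderiv]
    exact ((jetSuccEquiv l).toContinuousLinearEquiv.integral_comp_comm _).symm

/-- A linear functional dominated by the norm of a linear map factors continuously through it. -/
lemma exists_factor_of_norm_le {S X : Type*} [AddCommGroup S] [Module ℂ S]
    [NormedAddCommGroup X] [NormedSpace ℂ X] (u : S →ₗ[ℂ] ℂ) (J : S →ₗ[ℂ] X) (C : ℝ)
    (h : ∀ g, ‖u g‖ ≤ C * ‖J g‖) : ∃ L : X →L[ℂ] ℂ, ∀ g, L (J g) = u g := by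
  have hu : u ∈ (LinearMap.ker J).dualAnnihilator := by
    rw [Submodule.mem_dualAnnihilator]
    intro g hg
    have := h g
    rw [LinearMap.mem_ker.1 hg, norm_zero, mul_zero] at this
    exact norm_le_zero_iff.1 this
  rw [← LinearMap.range_dualMap_eq_dualAnnihilator_ker] at hu
  obtain ⟨L₀, hL₀⟩ := hu
  have hL : ∀ g, L₀ (J g) = u g := fun g => LinearMap.congr_fun hL₀ g
  let L₁ : StrongDual ℂ (LinearMap.range J) :=
    (L₀.comp (LinearMap.range J).subtype).mkContinuous C (by
      rintro ⟨_, g, rfl⟩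
      simpa [hL] using h g)
  obtain ⟨L, hL', -⟩ := exists_extension_norm_eq _ L₁
  exact ⟨L, fun g => (hL' ⟨J g, g, rfl⟩).trans (hL g)⟩

lemma integral_comm_of_norm_le {S ι : Type*} [AddCommGroup S] [Module ℂ S] [Fintype ι]
    {X : ι → Type*} [∀ i, NormedAddCommGroup (X i)] [∀ i, NormedSpace ℂ (X i)]
    [∀ i, CompleteSpace (X i)] (u : S →ₗ[ℂ] ℂ) (J : (i : ι) → S →ₗ[ℂ] X i) (C : ℝ)
    (hC : 0 ≤ C) (h : ∀ g R, (∀ i, ‖J i g‖ ≤ R) → 0 ≤ R → ‖u g‖ ≤ C * R) {F : Z → S} {f : S}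
    (hF : ∀ i, Integrable (fun z => J i (F z)) μ) (hf : ∀ i, J i f = ∫ z, J i (F z) ∂μ) :
    u f = ∫ z, u (F z) ∂μ := by
  obtain ⟨L, hL⟩ := exists_factor_of_norm_le u (LinearMap.pi J) C
    fun g => h g _ (norm_le_pi_norm (LinearMap.pi J g)) (norm_nonneg _)
  have hint : Integrable (fun z => LinearMap.pi J (F z)) μ := Integrable.of_eval hF
  have : ∫ z, LinearMap.pi J (F z) ∂μ = LinearMap.pi J f := by
    funext i
    exact (eval_integral (f := fun z i => J i (F z)) hF i).trans (hf i).symm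
  rw [← hL f, ← this, ← L.integral_comp_comm hint]
  simp only [hL]

/-- A tempered distribution commutes with absolutely convergent integrals of
Schwartz functions. -/
theorem tempered_integral_comm [OpensMeasurableSpace Z] [SecondCountableTopology Z]
    (u : 𝓢(E, ℂ) →L[ℂ] ℂ) {F : Z → 𝓢(E, ℂ)} (hF : Continuous F)
    (hint : ∀ k l, Integrable (fun z => SchwartzMap.seminorm ℂ k l (F z)) μ)
    {f : 𝓢(E, ℂ)} (hf : ∀ x, f x = ∫ z, F z x ∂μ) :
    u f = ∫ z, u (F z) ∂μ := by
  obtain ⟨s, C, -, hC⟩ := Seminorm.bound_of_continuous (schwartz_withSeminorms ℂ E ℂ)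
    ((normSeminorm ℂ ℂ).comp u.toLinearMap) (continuous_norm.comp u.continuous)
  have hJ (k l : ℕ) : Integrable (fun z => weightedJet k l (F z)) μ :=
    (hint k l).mono' ((weightedJet k l).continuous.comp hF).aestronglyMeasurable
      (Filter.Eventually.of_forall fun z => norm_weightedJet_le k l (F z))
  refine integral_comm_of_norm_le u.toLinearMap
    (fun i : s => (weightedJet (E := E) i.1.1 i.1.2).toLinearMap) C C.2 ?_
    (fun i => hJ i.1.1 i.1.2) fun i => ?_
  · intro g R hR hR0
    refine (hC g).trans ?_
    rw [smul_apply, NNReal.smul_def, smul_eq_mul]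
    gcongr
    refine Seminorm.finset_sup_apply_le hR0 fun i hi => ?_
    exact (seminorm_le_norm_weightedJet i.1 i.2 g).trans (hR ⟨i, hi⟩)
  · ext1 x
    change (‖x‖ ^ i.1.1 : ℝ) • jet i.1.2 f x =
      BoundedContinuousFunction.evalCLM ℝ x (∫ z, weightedJet i.1.1 i.1.2 (F z) ∂μ)
    rw [← ContinuousLinearMap.integral_comp_comm _ (hJ i.1.1 i.1.2),
      jet_integral hF hint hf, ← integral_smul]
    rfl

end Integral

open scoped SchwartzMap FourierTransform

section SeminormBounds

variable {E : Type*} [NormedAddCommGroup E] [NormedSpace ℝ E]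

lemma exists_le_sum_seminorm {q : Seminorm ℂ 𝓢(E, ℂ)} (hq : Continuous q) :
    ∃ (s : Finset (ℕ × ℕ)) (C : ℝ), 0 ≤ C ∧
      ∀ f, q f ≤ C * ∑ i ∈ s, SchwartzMap.seminorm ℂ i.1 i.2 f := by
  obtain ⟨s, C, -, h⟩ := Seminorm.bound_of_continuous (schwartz_withSeminorms ℂ E ℂ) q hq
  refine ⟨s, C, C.2, fun f => (h f).trans ?_⟩
  rw [smul_apply, NNReal.smul_def, smul_eq_mul]
  gcongr
  refine (Seminorm.finset_sup_le_sum (schwartzSeminormFamily ℂ E ℂ) s f).trans_eq ?_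
  rw [sum_apply]
  rfl

lemma continuous_seminorm (k l : ℕ) : Continuous (SchwartzMap.seminorm ℂ k l : Seminorm ℂ 𝓢(E, ℂ)) :=
  (schwartz_withSeminorms ℂ E ℂ).continuous_seminorm (k, l)

/-- A family of operators on Schwartz space whose bounds grow at most polynomially in the
weight `w`. -/
def PolyBounded {ι : Type*} (w : ι → ℝ) (T : ι → 𝓢(E, ℂ) →L[ℂ] 𝓢(E, ℂ)) : Prop :=
  ∀ q : Seminorm ℂ 𝓢(E, ℂ), Continuous q → ∃ q' : Seminorm ℂ 𝓢(E, ℂ), Continuous q' ∧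
    ∃ M : ℕ, ∀ i f, q (T i f) ≤ w i ^ M * q' f

namespace PolyBounded

variable {ι : Type*} {w : ι → ℝ} {T S : ι → 𝓢(E, ℂ) →L[ℂ] 𝓢(E, ℂ)}

lemma const (T : 𝓢(E, ℂ) →L[ℂ] 𝓢(E, ℂ)) : PolyBounded w fun _ => T :=
  fun q hq => ⟨q.comp T.toLinearMap, hq.comp T.continuous, 0, fun i f => by simp⟩

lemma comp (hw : ∀ i, 1 ≤ w i) (hT : PolyBounded w T) (hS : PolyBounded w S) :
    PolyBounded w fun i => T i ∘L S i := by
  intro q hq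
  obtain ⟨q₁, hq₁, M₁, h₁⟩ := hT q hq
  obtain ⟨q₂, hq₂, M₂, h₂⟩ := hS q₁ hq₁
  refine ⟨q₂, hq₂, M₁ + M₂, fun i f => (h₁ i (S i f)).trans ?_⟩
  have : 0 ≤ w i := by linarith [hw i]
  rw [pow_add, mul_assoc]
  gcongr
  exact h₂ i f

lemma mono {w' : ι → ℝ} (hw : ∀ i, 0 ≤ w i) (h : ∀ i, w i ≤ w' i) (hT : PolyBounded w T) :
    PolyBounded w' T := by
  intro q hq
  obtain ⟨q₁, hq₁, M₁, h₁⟩ := hT q hq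
  refine ⟨q₁, hq₁, M₁, fun i f => (h₁ i f).trans ?_⟩
  have := hw i
  have := h i
  gcongr

lemma comp_index {κ : Type*} (hT : PolyBounded w T) (e : κ → ι) :
    PolyBounded (fun j => w (e j)) fun j => T (e j) := by
  intro q hq
  obtain ⟨q₁, hq₁, M₁, h₁⟩ := hT q hq
  exact ⟨q₁, hq₁, M₁, fun i f => h₁ (e i) f⟩

lemma of_seminorm (hw : ∀ i, 1 ≤ w i)
    (h : ∀ k l, ∃ q' : Seminorm ℂ 𝓢(E, ℂ), Continuous q' ∧
      ∃ M : ℕ, ∀ i f, SchwartzMap.seminorm ℂ k l (T i f) ≤ w i ^ M * q' f) :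
    PolyBounded w T := by
  intro q hq
  obtain ⟨s, C, hC, hs⟩ := exists_le_sum_seminorm hq
  choose Q hQ M hM using h
  refine ⟨C.toNNReal • ∑ i ∈ s, Q i.1 i.2, ?_, ∑ i ∈ s, M i.1 i.2, fun i f => ?_⟩
  · have : ⇑(C.toNNReal • ∑ i ∈ s, Q i.1 i.2) = fun f => C * ∑ i ∈ s, Q i.1 i.2 f := by
      funext f
      simp [NNReal.smul_def, hC]
    rw [this]
    exact continuous_const.mul (continuous_finsetSum _ fun i _ => hQ i.1 i.2)
  · refine (hs _).trans ?_
    rw [smul_apply, NNReal.smul_def, Real.coe_toNNReal _ hC, sum_apply, smul_eq_mul,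
      mul_left_comm]
    refine mul_le_mul_of_nonneg_left ?_ hC
    rw [Finset.mul_sum]
    refine Finset.sum_le_sum fun j hj => ?_
    refine (hM j.1 j.2 i f).trans ?_
    gcongr
    · exact hw i
    · exact Finset.single_le_sum (f := fun i : ℕ × ℕ => M i.1 i.2) (fun _ _ => Nat.zero_le _) hj

/-- A tempered distribution grows polynomially along a polynomially bounded family. -/
lemma norm_apply_le (hT : PolyBounded w T) (u : 𝓢(E, ℂ) →L[ℂ] ℂ) :
    ∃ q : Seminorm ℂ 𝓢(E, ℂ), Continuous q ∧ ∃ M : ℕ, ∀ i f, ‖u (T i f)‖ ≤ w i ^ M * q f :=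
  hT ((normSeminorm ℂ ℂ).comp u.toLinearMap) (continuous_norm.comp u.continuous)

end PolyBounded

lemma exists_pow_mul_norm_le (f : 𝓢(E, ℂ)) (k : ℕ) :
    ∃ C, 0 ≤ C ∧ ∀ x, ‖f x‖ * (1 + ‖x‖) ^ k ≤ C := by
  refine ⟨2 ^ k * (Finset.Iic (k, 0)).sup (fun m => SchwartzMap.seminorm ℂ m.1 m.2) f,
    by positivity, fun x => ?_⟩
  have := SchwartzMap.one_add_le_sup_seminorm_apply (𝕜 := ℂ) (m := (k, 0)) le_rfl le_rfl f x
  simpa [mul_comm] using this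

lemma add_pow_mul_norm_le (f : 𝓢(E, ℂ)) (k l : ℕ) {c : ℝ} (hc : 0 ≤ c) (x y : E)
    (h : ‖x‖ ≤ ‖y‖ + c) : ‖x‖ ^ k * ‖iteratedFDeriv ℝ l f y‖ ≤
      2 ^ k * (SchwartzMap.seminorm ℂ k l f + c ^ k * SchwartzMap.seminorm ℂ 0 l f) := by
  have h1 : ‖x‖ ^ k ≤ 2 ^ k * (‖y‖ ^ k + c ^ k) := by
    refine (pow_le_pow_left₀ (norm_nonneg _) h k).trans ?_
    refine (add_pow_le (norm_nonneg _) hc k).trans ?_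
    gcongr
    · norm_num
    · omega
  calc _ ≤ 2 ^ k * (‖y‖ ^ k + c ^ k) * ‖iteratedFDeriv ℝ l f y‖ := by gcongr
    _ = 2 ^ k * (‖y‖ ^ k * ‖iteratedFDeriv ℝ l f y‖ + c ^ k * ‖iteratedFDeriv ℝ l f y‖) := by ring
    _ ≤ _ := by
      gcongr
      · exact f.le_seminorm ℂ k l y
      · exact f.norm_iteratedFDeriv_le_seminorm ℂ l y

lemma iteratedFDeriv_compSubConst (f : 𝓢(E, ℂ)) (l : ℕ) (h x : E) :
    iteratedFDeriv ℝ l (f.compSubConstCLM ℂ h) x = iteratedFDeriv ℝ l f (x - h) :=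
  iteratedFDeriv_comp_sub (f := f) l h x

lemma polyBounded_compSubConst :
    PolyBounded (fun h : E => 1 + ‖h‖) fun h => SchwartzMap.compSubConstCLM ℂ h := by
  refine PolyBounded.of_seminorm (fun h => by linarith [norm_nonneg h]) fun k l => ?_
  refine ⟨(2 ^ k : NNReal) • (SchwartzMap.seminorm ℂ k l + SchwartzMap.seminorm ℂ 0 l), ?_, k,
    fun h f => ?_⟩
  · have : ⇑((2 ^ k : NNReal) • (SchwartzMap.seminorm ℂ k l + SchwartzMap.seminorm ℂ 0 l :
        Seminorm ℂ 𝓢(E, ℂ))) = fun f => (2 : ℝ) ^ k *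
          (SchwartzMap.seminorm ℂ k l f + SchwartzMap.seminorm ℂ 0 l f) := by
      funext f
      simp [NNReal.smul_def, mul_add]
    rw [this]
    exact continuous_const.mul ((continuous_seminorm k l).add (continuous_seminorm 0 l))
  · refine SchwartzMap.seminorm_le_bound ℂ k l _ (by positivity) fun x => ?_
    rw [iteratedFDeriv_compSubConst]
    refine (add_pow_mul_norm_le f k l (norm_nonneg h) x (x - h) ?_).trans ?_
    · simpa using norm_add_le (x - h) h
    · have h1 : 1 ≤ (1 + ‖h‖) ^ k := one_le_pow₀ (by linarith [norm_nonneg h])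
      have h2 : ‖h‖ ^ k ≤ (1 + ‖h‖) ^ k := by gcongr; linarith
      have e : ((2 ^ k : NNReal) • (SchwartzMap.seminorm ℂ k l + SchwartzMap.seminorm ℂ 0 l :
        Seminorm ℂ 𝓢(E, ℂ))) f = (2 : ℝ) ^ k *
          (SchwartzMap.seminorm ℂ k l f + SchwartzMap.seminorm ℂ 0 l f) := by
        simp [NNReal.smul_def, mul_add]
      rw [e, mul_left_comm, mul_add ((1 + ‖h‖) ^ k)]
      gcongr
      exact le_mul_of_one_le_left (by positivity) h1

lemma continuous_compSubConst (f : 𝓢(E, ℂ)) : Continuous fun h : E => f.compSubConstCLM ℂ h := by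
  refine continuous_iff_continuousAt.2 fun h₀ => ?_
  refine ((schwartz_withSeminorms ℂ E ℂ).tendsto_nhds _ _).2 fun ⟨k, l⟩ ε hε => ?_
  set C := 2 ^ k * (SchwartzMap.seminorm ℂ k (l + 1) f +
    (1 + ‖h₀‖) ^ k * SchwartzMap.seminorm ℂ 0 (l + 1) f) with hC
  have hC0 : 0 ≤ C := by positivity
  have key : ∀ h ∈ Metric.ball h₀ 1, SchwartzMap.seminorm ℂ k l
      (f.compSubConstCLM ℂ h - f.compSubConstCLM ℂ h₀) ≤ C * ‖h - h₀‖ := by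
    intro h hh
    rw [mem_ball_iff_norm] at hh
    refine SchwartzMap.seminorm_le_bound ℂ k l _ (by positivity) fun x => ?_
    have e : iteratedFDeriv ℝ l ⇑(f.compSubConstCLM ℂ h - f.compSubConstCLM ℂ h₀) x =
        iteratedFDeriv ℝ l f (x - h) - iteratedFDeriv ℝ l f (x - h₀) := by
      rw [← iteratedFDeriv_compSubConst, ← iteratedFDeriv_compSubConst]
      exact iteratedFDeriv_sub_apply ((f.compSubConstCLM ℂ h).smooth l).contDiffAt
        ((f.compSubConstCLM ℂ h₀).smooth l).contDiffAt
    rw [e]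
    have hd : Differentiable ℝ (iteratedFDeriv ℝ l f) :=
      (f.smooth (l + 1 : ℕ)).differentiable_iteratedFDeriv (by exact_mod_cast l.lt_succ_self)
    have := (convex_ball (x - h₀) 1).norm_image_sub_le_of_norm_fderiv_le (𝕜 := ℝ)
      (f := fun y => (‖x‖ ^ k : ℝ) • iteratedFDeriv ℝ l f y) (C := C) (x := x - h₀) (y := x - h)
      (fun y _ => (hd y).fun_const_smul _) ?_ (by simp)
      (by rw [mem_ball_iff_norm]; simpa [norm_sub_rev] using hh)
    · simpa [← smul_sub, norm_smul, norm_sub_rev] using this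
    · intro y hy
      rw [mem_ball_iff_norm] at hy
      rw [fderiv_fun_const_smul (hd y), norm_smul, norm_fderiv_iteratedFDeriv,
        Real.norm_of_nonneg (by positivity)]
      refine add_pow_mul_norm_le f k (l + 1) (by positivity) x y ?_
      calc ‖x‖ = ‖y - (y - (x - h₀)) + h₀‖ := by congr 1; abel
        _ ≤ ‖y‖ + ‖y - (x - h₀)‖ + ‖h₀‖ := (norm_add_le _ _).trans (by gcongr; exact norm_sub_le _ _)
        _ ≤ _ := by linarith
  have hlim : Filter.Tendsto (fun h => C * ‖h - h₀‖) (nhds h₀) (nhds 0) := by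
    have : Continuous fun h => C * ‖h - h₀‖ := by fun_prop
    simpa using this.tendsto h₀
  filter_upwards [hlim.eventually (gt_mem_nhds hε), Metric.ball_mem_nhds h₀ one_pos] with h h1 h2
  exact (key h h2).trans_lt h1

end SeminormBounds

/-- Multiplication of a Schwartz function by the plane wave `y ↦ e^{-i y·ζ}`. -/
def modulate (ζ : Euc n) : 𝓢(Euc n, ℂ) →L[ℂ] 𝓢(Euc n, ℂ) :=
  FourierTransform.fourierInvCLM ℂ 𝓢(Euc n, ℂ) ∘L
    SchwartzMap.compSubConstCLM ℂ (-((2 * Real.pi)⁻¹ • ζ)) ∘L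
      FourierTransform.fourierCLM ℂ 𝓢(Euc n, ℂ)

lemma modulate_apply (ζ : Euc n) (f : 𝓢(Euc n, ℂ)) (y : Euc n) :
    modulate ζ f y = f y * Complex.exp (-Complex.I * ((⟪y, ζ⟫_ℝ : ℝ) : ℂ)) := by
  set h := (2 * Real.pi)⁻¹ • ζ with hh
  have h1 : modulate ζ f y = 𝓕⁻ (fun η : Euc n => (𝓕 f : 𝓢(Euc n, ℂ)) (η + h)) y := by
    have : modulate ζ f = 𝓕⁻ ((𝓕 f).compSubConstCLM ℂ (-h)) := rfl
    rw [this, SchwartzMap.fourierInv_coe]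
    have : ⇑((𝓕 f : 𝓢(Euc n, ℂ)).compSubConstCLM ℂ (-h)) =
        fun η : Euc n => (𝓕 f : 𝓢(Euc n, ℂ)) (η + h) := by
      funext η
      simp
    rw [this]
  have h2 : f y = 𝓕⁻ (⇑(𝓕 f : 𝓢(Euc n, ℂ))) y := by
    rw [← SchwartzMap.fourierInv_coe, FourierTransform.fourierInv_fourier_eq]
  rw [h1, h2, Real.fourierInv_eq', Real.fourierInv_eq', ← integral_mul_const]
  refine Eq.trans ?_ (integral_add_right_eq_self _ h)
  congr 1
  funext η
  have h3 : 2 * Real.pi * ⟪η + h, y⟫_ℝ = 2 * Real.pi * ⟪η, y⟫_ℝ + ⟪y, ζ⟫_ℝ := by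
    have : 2 * Real.pi ≠ 0 := by positivity
    rw [inner_add_left, hh, real_inner_smul_left, real_inner_comm y ζ, mul_add,
      mul_inv_cancel_left₀ this]
  rw [h3, smul_eq_mul, smul_eq_mul, mul_right_comm (cexp _), ← Complex.exp_add]
  congr 2
  push_cast
  ring

lemma polyBounded_modulate : PolyBounded (fun ζ : Euc n => 1 + ‖ζ‖) modulate := by
  have hw : ∀ ζ : Euc n, 1 ≤ 1 + ‖ζ‖ := fun ζ => by linarith [norm_nonneg ζ]
  refine (PolyBounded.const _).comp hw (.comp hw ?_ (.const _))
  refine (polyBounded_compSubConst.comp_index fun ζ : Euc n => -((2 * Real.pi)⁻¹ • ζ)).mono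
    (fun ζ => by positivity) fun ζ => ?_
  rw [norm_neg, norm_smul, Real.norm_of_nonneg (by positivity)]
  gcongr
  refine mul_le_of_le_one_left (norm_nonneg _) (inv_le_one_of_one_le₀ ?_)
  linarith [Real.pi_gt_three]

lemma continuous_modulate (f : 𝓢(Euc n, ℂ)) : Continuous fun ζ => modulate ζ f := by
  refine (FourierTransform.fourierInvCLM ℂ 𝓢(Euc n, ℂ)).continuous.comp ?_
  exact (continuous_compSubConst (𝓕 f)).comp (by fun_prop)

section Convolution

/-- `Γ'` is conically well inside `Γ`: bounded parts of `Γ'` away from the origin keep a positive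
distance to the complement of `Γ`. -/
def WellInside (Γ' Γ : Set (Euc n)) : Prop :=
  ∀ a : ℝ, 1 ≤ a → ∃ δ : ℝ, 0 < δ ∧ ∀ ξ ∈ Γ', a⁻¹ ≤ ‖ξ‖ → ‖ξ‖ ≤ a →
    ∀ θ : Euc n, ‖θ‖ ≤ δ → ξ - θ ∈ Γ

lemma IsConicNbhd.exists_wellInside {Γ : Set (Euc n)} {ξ₀ : Euc n} (h : IsConicNbhd Γ ξ₀) :
    ∃ Γ', IsConicNbhd Γ' ξ₀ ∧ WellInside Γ' Γ := by
  obtain ⟨ε, hε, hball⟩ := Metric.mem_nhds_iff.1 h.1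
  refine ⟨{ξ | ∃ c : ℝ, 0 < c ∧ ‖c • ξ - ξ₀‖ < ε / 2}, ⟨?_, ?_⟩, ?_⟩
  · filter_upwards [Metric.ball_mem_nhds ξ₀ (half_pos hε)] with ξ hξ
    exact ⟨1, one_pos, by rwa [one_smul, ← mem_ball_iff_norm]⟩
  · rintro ξ ⟨c, hc, hξ⟩ d hd
    exact ⟨c / d, by positivity, by rwa [smul_smul, div_mul_cancel₀ _ hd.ne']⟩
  · intro a ha
    have ha0 : 0 < a := by linarith
    set D := a * (‖ξ₀‖ + ε / 2) with hD
    have hD0 : 0 < D := by positivity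
    refine ⟨ε / 2 / D, by positivity, ?_⟩
    rintro ξ ⟨c, hc, hξ⟩ h1 - θ hθ
    have hcD : c ≤ D := by
      have h2 : c * ‖ξ‖ ≤ ‖ξ₀‖ + ε / 2 := by
        rw [← Real.norm_of_nonneg hc.le, ← norm_smul]
        have := norm_add_le (c • ξ - ξ₀) ξ₀
        rw [sub_add_cancel] at this
        linarith
      have h3 : c * a⁻¹ ≤ ‖ξ₀‖ + ε / 2 := (by gcongr : c * a⁻¹ ≤ c * ‖ξ‖).trans h2
      rw [← div_eq_mul_inv, div_le_iff₀ ha0] at h3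
      linarith
    have hmem : c • (ξ - θ) ∈ Γ := by
      apply hball
      rw [mem_ball_iff_norm]
      calc ‖c • (ξ - θ) - ξ₀‖ = ‖(c • ξ - ξ₀) - c • θ‖ := by congr 1; rw [smul_sub]; abel
        _ ≤ ‖c • ξ - ξ₀‖ + c * ‖θ‖ := by
          refine (norm_sub_le _ _).trans_eq ?_
          rw [norm_smul, Real.norm_of_nonneg hc.le]
        _ < ε / 2 + D * (ε / 2 / D) := by
          refine add_lt_add_of_lt_of_le hξ ?_
          gcongr
        _ = ε := by field_simp; norm_num
    simpa [smul_smul, hc.ne'] using h.2 _ hmem c⁻¹ (by positivity)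

variable {ι : Type*}

/-- Polynomial growth, uniformly up to powers of the parameter `L`. -/
def PolyGrowth (L : ι → ℝ) (G : ι → Euc n → ℂ) : Prop :=
  ∃ (C : ℝ) (M : ℕ), 0 ≤ C ∧ ∀ i ζ, ‖G i ζ‖ ≤ C * (L i * (1 + ‖ζ‖)) ^ M

/-- Rapid decay in the parameter `L` along the dilated truncated cone `L • Γ`. -/
def RapidOn (L : ι → ℝ) (G : ι → Euc n → ℂ) (Γ : Set (Euc n)) : Prop :=
  ∀ (N : ℕ) (a : ℝ), 1 ≤ a → ∃ C : ℝ, 0 ≤ C ∧ ∀ i, ∀ ξ ∈ Γ, a⁻¹ ≤ ‖ξ‖ → ‖ξ‖ ≤ a →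
    ‖G i (L i • ξ)‖ * L i ^ N ≤ C

/-- Schwartz-type decay with losses governed by the scale `L ^ b`. -/
def ScaledDecay (b : ℝ) (L : ι → ℝ) (H : ι → Euc n → ℂ) : Prop :=
  ∀ k : ℕ, ∃ C : ℝ, 0 ≤ C ∧ ∀ i η, ‖H i η‖ * (1 + ‖η‖) ^ k ≤ C * (L i ^ b) ^ k

lemma RapidOn.mono {L : ι → ℝ} {G : ι → Euc n → ℂ} {Γ Γ' : Set (Euc n)} (h : RapidOn L G Γ)
    (hΓ : Γ' ⊆ Γ) : RapidOn L G Γ' := fun N a ha =>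
  let ⟨C, hC, h⟩ := h N a ha
  ⟨C, hC, fun i ξ hξ => h i ξ (hΓ hξ)⟩

lemma one_add_norm_sub_le (ζ η : Euc n) :
    1 + ‖ζ - (2 * Real.pi) • η‖ ≤ (1 + ‖ζ‖) * (7 * (1 + ‖η‖)) := by
  have h := norm_sub_le ζ ((2 * Real.pi) • η)
  rw [norm_smul, Real.norm_of_nonneg (by positivity)] at h
  have : 2 * Real.pi * ‖η‖ ≤ 7 * ‖η‖ := by gcongr; linarith [Real.pi_lt_d2]
  nlinarith [norm_nonneg ζ, norm_nonneg η, mul_nonneg (norm_nonneg ζ) (norm_nonneg η)]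

lemma integrable_inv_one_add_norm_pow :
    Integrable fun η : Euc n => ((1 + ‖η‖) ^ (n + 1))⁻¹ := by
  have := integrable_one_add_norm (E := Euc n) (μ := volume) (r := (n + 1 : ℕ)) (by simp)
  refine this.congr (Filter.Eventually.of_forall fun η => ?_)
  simp only
  rw [Real.rpow_neg (by positivity), Real.rpow_natCast]

lemma norm_integral_le_of_decay {f : Euc n → ℂ} {A : ℝ}
    (h : ∀ η, ‖f η‖ * (1 + ‖η‖) ^ (n + 1) ≤ A) :
    ‖∫ η, f η‖ ≤ A * ∫ η : Euc n, ((1 + ‖η‖) ^ (n + 1))⁻¹ := by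
  rw [← integral_const_mul]
  refine norm_integral_le_of_norm_le (integrable_inv_one_add_norm_pow.const_mul A)
    (Filter.Eventually.of_forall fun η => ?_)
  rw [← div_eq_mul_inv, le_div_iff₀ (by positivity)]
  exact h η

variable {L : ι → ℝ} {G H : ι → Euc n → ℂ} {b : ℝ}

lemma rpow_pow_le_pow {l : ℝ} (hl : 1 ≤ l) (hb1 : b < 1) (k : ℕ) : (l ^ b) ^ k ≤ l ^ k := by
  gcongr
  simpa using Real.rpow_le_rpow_of_exponent_le hl hb1.le

lemma PolyGrowth.convolution (hL : ∀ i, 1 ≤ L i) (hb1 : b < 1) (hG : PolyGrowth L G)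
    (hH : ScaledDecay b L H) :
    PolyGrowth L fun i ζ => ∫ η, H i η * G i (ζ - (2 * Real.pi) • η) := by
  obtain ⟨C, M, hC, hG⟩ := hG
  obtain ⟨D, hD, hH⟩ := hH (M + (n + 1))
  set J := ∫ η : Euc n, ((1 + ‖η‖) ^ (n + 1))⁻¹
  have hJ : 0 ≤ J := integral_nonneg fun η => by positivity
  refine ⟨C * 7 ^ M * D * J, M + (M + (n + 1)), by positivity, fun i ζ => ?_⟩
  have hLi := hL i
  have hL0 : 0 ≤ L i := by linarith
  refine (norm_integral_le_of_decay (A := C * 7 ^ M * D *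
    (L i * (1 + ‖ζ‖)) ^ (M + (M + (n + 1)))) fun η => ?_).trans_eq (by ring)
  rw [norm_mul]
  calc ‖H i η‖ * ‖G i (ζ - (2 * Real.pi) • η)‖ * (1 + ‖η‖) ^ (n + 1)
      ≤ ‖H i η‖ * (C * (L i * ((1 + ‖ζ‖) * (7 * (1 + ‖η‖)))) ^ M) * (1 + ‖η‖) ^ (n + 1) := by
        gcongr
        refine (hG _ _).trans ?_
        gcongr
        exact one_add_norm_sub_le ζ η
    _ = C * 7 ^ M * (L i * (1 + ‖ζ‖)) ^ M * (‖H i η‖ * (1 + ‖η‖) ^ (M + (n + 1))) := by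
        rw [← mul_assoc (L i), mul_pow, mul_pow 7, pow_add]; ring
    _ ≤ C * 7 ^ M * (L i * (1 + ‖ζ‖)) ^ M * (D * (L i * (1 + ‖ζ‖)) ^ (M + (n + 1))) := by
        refine mul_le_mul_of_nonneg_left ((hH i η).trans ?_) (by positivity)
        gcongr
        refine (by simpa using rpow_pow_le_pow hLi hb1 1 : L i ^ b ≤ L i).trans ?_
        exact le_mul_of_one_le_right hL0 (by linarith [norm_nonneg ζ])
    _ = _ := by rw [pow_add]; ring

lemma RapidOn.convolution {Γ Γ' : Set (Euc n)} (hL : ∀ i, 1 ≤ L i) (hb1 : b < 1)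
    (hG : PolyGrowth L G) (hG' : RapidOn L G Γ) (hΓ : WellInside Γ' Γ) (hH : ScaledDecay b L H) :
    RapidOn L (fun i ζ => ∫ η, H i η * G i (ζ - (2 * Real.pi) • η)) Γ' := by
  intro N a ha
  have ha0 : 0 < a := by linarith
  obtain ⟨δ₀, hδ₀, hin⟩ := hΓ a ha
  set δ := min δ₀ (2 * a)⁻¹ with hδdef
  have hδ : 0 < δ := lt_min hδ₀ (by positivity)
  obtain ⟨C₁, hC₁, hG₁⟩ := hG' (N + (n + 1)) (2 * a) (by linarith)
  obtain ⟨D₁, hD₁, hH₁⟩ := hH (n + 1)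
  obtain ⟨C, M, hC, hG⟩ := hG
  obtain ⟨p, hp⟩ := exists_nat_ge ((N + 3 * M + (n + 1)) / (1 - b))
  obtain ⟨D, hD, hH⟩ := hH (p + M + (n + 1))
  set J := ∫ η : Euc n, ((1 + ‖η‖) ^ (n + 1))⁻¹
  have hJ : 0 ≤ J := integral_nonneg fun η => by positivity
  refine ⟨(C₁ * D₁ + C * (14 * a) ^ M * D * (7 / δ) ^ p) * J, by positivity,
    fun i ξ hξ h1 h2 => ?_⟩
  have hLi := hL i
  have hL0 : 0 < L i := by linarith
  rw [← le_div_iff₀ (by positivity), mul_div_right_comm]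
  refine norm_integral_le_of_decay fun η => ?_
  rw [norm_mul, le_div_iff₀ (by positivity)]
  by_cases hη : 2 * Real.pi * ‖η‖ ≤ δ * L i
  · refine le_trans ?_ (le_add_of_nonneg_right (by positivity))
    set θ : Euc n := (2 * Real.pi / L i) • η with hθ
    have hθn : ‖θ‖ ≤ δ := by
      rw [hθ, norm_smul, Real.norm_of_nonneg (by positivity), div_mul_eq_mul_div,
        div_le_iff₀ hL0]
      exact hη
    have harg : L i • ξ - (2 * Real.pi) • η = L i • (ξ - θ) := by
      rw [smul_sub, hθ, smul_smul, mul_div_cancel₀ _ hL0.ne']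
    have hθ2 : ‖θ‖ ≤ (2 * a)⁻¹ := hθn.trans (min_le_right _ _)
    have hinv : a⁻¹ = 2 * (2 * a)⁻¹ := by field_simp
    have hle1 : (2 * a)⁻¹ ≤ a := (inv_le_one_of_one_le₀ (by linarith)).trans ha
    have hg := hG₁ i (ξ - θ) (hin ξ hξ h1 h2 θ (hθn.trans (min_le_left _ _)))
      (by linarith [norm_sub_norm_le ξ θ]) (by linarith [norm_sub_le ξ θ])
    rw [← harg] at hg
    have hh := (hH₁ i η).trans (mul_le_mul_of_nonneg_left (rpow_pow_le_pow hLi hb1 _) hD₁)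
    calc ‖H i η‖ * ‖G i (L i • ξ - (2 * Real.pi) • η)‖ * (1 + ‖η‖) ^ (n + 1) * L i ^ N
        = (‖H i η‖ * (1 + ‖η‖) ^ (n + 1)) *
            (‖G i (L i • ξ - (2 * Real.pi) • η)‖ * L i ^ N) := by ring
      _ ≤ (D₁ * L i ^ (n + 1)) * (‖G i (L i • ξ - (2 * Real.pi) • η)‖ * L i ^ N) :=
        mul_le_mul_of_nonneg_right hh (by positivity)
      _ = D₁ * (‖G i (L i • ξ - (2 * Real.pi) • η)‖ * L i ^ (N + (n + 1))) := by
        rw [pow_add]; ring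
      _ ≤ D₁ * C₁ := mul_le_mul_of_nonneg_left hg hD₁
      _ = C₁ * D₁ := mul_comm _ _
  · refine le_trans ?_ (le_add_of_nonneg_left (by positivity))
    push Not at hη
    have hη' : δ / 7 * L i ≤ 1 + ‖η‖ := by
      have : 2 * Real.pi * ‖η‖ ≤ 7 * ‖η‖ := by gcongr; linarith [Real.pi_lt_d2]
      linarith
    have hg : ‖G i (L i • ξ - (2 * Real.pi) • η)‖ ≤
        C * ((14 * a) ^ M * L i ^ (2 * M) * (1 + ‖η‖) ^ M) := by
      refine (hG _ _).trans ?_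
      rw [pow_mul, ← mul_pow, ← mul_pow]
      refine mul_le_mul_of_nonneg_left (pow_le_pow_left₀ (by positivity) ?_ M) hC
      have h3 : 1 + ‖L i • ξ‖ ≤ 2 * a * L i := by
        rw [norm_smul, Real.norm_of_nonneg hL0.le]
        nlinarith
      calc L i * (1 + ‖L i • ξ - (2 * Real.pi) • η‖)
          ≤ L i * ((2 * a * L i) * (7 * (1 + ‖η‖))) := by
            gcongr
            refine (one_add_norm_sub_le _ _).trans ?_
            gcongr
        _ = _ := by ring
    have hpow : (L i ^ b) ^ (p + M + (n + 1)) * L i ^ (2 * M + N) ≤ L i ^ p := by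
      rw [← Real.rpow_natCast, ← Real.rpow_mul hL0.le, ← Real.rpow_natCast (L i) (2 * M + N),
        ← Real.rpow_add hL0, ← Real.rpow_natCast (L i) p]
      refine Real.rpow_le_rpow_of_exponent_le hLi ?_
      rw [div_le_iff₀ (by linarith)] at hp
      push_cast
      nlinarith [(by positivity : (0 : ℝ) ≤ M + (n + 1))]
    have key : ‖H i η‖ * ‖G i (L i • ξ - (2 * Real.pi) • η)‖ * (1 + ‖η‖) ^ (n + 1) * L i ^ N *
        (δ / 7 * L i) ^ p ≤ C * (14 * a) ^ M * D * L i ^ p := by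
      calc _ ≤ ‖H i η‖ * (C * ((14 * a) ^ M * L i ^ (2 * M) * (1 + ‖η‖) ^ M)) *
            (1 + ‖η‖) ^ (n + 1) * L i ^ N * (1 + ‖η‖) ^ p := by gcongr
        _ = C * (14 * a) ^ M * L i ^ (2 * M + N) *
            (‖H i η‖ * (1 + ‖η‖) ^ (p + M + (n + 1))) := by simp only [pow_add]; ring
        _ ≤ C * (14 * a) ^ M * L i ^ (2 * M + N) * (D * (L i ^ b) ^ (p + M + (n + 1))) :=
          mul_le_mul_of_nonneg_left (hH i η) (by positivity)
        _ = C * (14 * a) ^ M * D * ((L i ^ b) ^ (p + M + (n + 1)) * L i ^ (2 * M + N)) := by ring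
        _ ≤ _ := mul_le_mul_of_nonneg_left hpow (by positivity)
    rw [← le_div_iff₀ (by positivity)] at key
    refine key.trans_eq ?_
    rw [mul_pow (δ / 7), div_pow, div_pow]
    field_simp

end Convolution

section Windows

/-- The product of two Schwartz functions, as an operator in the second factor. -/
def mulSchwartz (m : 𝓢(Euc n, ℂ)) : 𝓢(Euc n, ℂ) →L[ℂ] 𝓢(Euc n, ℂ) :=
  SchwartzMap.pairing (ContinuousLinearMap.mul ℂ ℂ) m

@[simp]
lemma mulSchwartz_apply (m g : 𝓢(Euc n, ℂ)) (y : Euc n) : mulSchwartz m g y = m y * g y := rfl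

/-- The complex conjugate of a Schwartz function. -/
def conjSchwartz (f : 𝓢(Euc n, ℂ)) : 𝓢(Euc n, ℂ) :=
  SchwartzMap.postcompCLM (𝕜 := ℝ) (Complex.conjCLE : ℂ →L[ℝ] ℂ) f

@[simp]
lemma conjSchwartz_apply (f : 𝓢(Euc n, ℂ)) (y : Euc n) :
    conjSchwartz f y = (starRingEnd ℂ) (f y) := rfl

lemma pairing_coe (u : 𝓢(Euc n, ℂ) →L[ℂ] ℂ) (ψ : 𝓢(Euc n, ℂ)) : pairing u ψ = u ψ := by
  have h : ∃ ψ' : 𝓢(Euc n, ℂ), (⇑ψ' : Euc n → ℂ) = ψ := ⟨ψ, rfl⟩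
  rw [pairing, dif_pos h, DFunLike.coe_injective h.choose_spec]

lemma pairing_mul_exp (u : 𝓢(Euc n, ℂ) →L[ℂ] ℂ) (ψ : 𝓢(Euc n, ℂ)) {f : Euc n → ℂ}
    (hf : ∀ y, f y = ψ y) (ζ : Euc n) :
    pairing u (fun y => f y * Complex.exp (-Complex.I * ((⟪y, ζ⟫_ℝ : ℝ) : ℂ))) =
      u (modulate ζ ψ) := by
  rw [← pairing_coe]
  congr 1
  funext y
  rw [modulate_apply, hf]

lemma apply_modulate_mulSchwartz (u : 𝓢(Euc n, ℂ) →L[ℂ] ℂ) (m g : 𝓢(Euc n, ℂ)) (ζ : Euc n) :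
    u (modulate ζ (mulSchwartz m g)) =
      ∫ η, (𝓕 m : 𝓢(Euc n, ℂ)) η * u (modulate (ζ - (2 * Real.pi) • η) g) := by
  set m' : 𝓢(Euc n, ℂ) := 𝓕 m with hm'
  have hF : Continuous fun η : Euc n => m' η • modulate (ζ - (2 * Real.pi) • η) g :=
    m'.continuous.smul ((continuous_modulate g).comp (by fun_prop))
  rw [tempered_integral_comm (μ := volume) u hF]
  · simp
  · intro k l
    obtain ⟨q, -, M, hq⟩ := polyBounded_modulate (n := n) _ (continuous_seminorm k l)
    obtain ⟨C, hC, hm⟩ := exists_pow_mul_norm_le m' (M + (n + 1))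
    refine (integrable_inv_one_add_norm_pow.const_mul
      (C * ((1 + ‖ζ‖) * 7) ^ M * q g)).mono'
      ((continuous_seminorm k l).comp hF).aestronglyMeasurable
      (Filter.Eventually.of_forall fun η => ?_)
    rw [Real.norm_of_nonneg (apply_nonneg _ _), map_smul_eq_mul, ← div_eq_mul_inv,
      le_div_iff₀ (by positivity)]
    calc _ ≤ ‖m' η‖ * (((1 + ‖ζ‖) * (7 * (1 + ‖η‖))) ^ M * q g) * (1 + ‖η‖) ^ (n + 1) := by
          gcongr
          refine (hq _ g).trans ?_
          gcongr
          exact one_add_norm_sub_le ζ η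
      _ = ‖m' η‖ * (1 + ‖η‖) ^ (M + (n + 1)) * (((1 + ‖ζ‖) * 7) ^ M * q g) := by
          rw [← mul_assoc (1 + ‖ζ‖), mul_pow _ (1 + ‖η‖), pow_add]; ring
      _ ≤ C * (((1 + ‖ζ‖) * 7) ^ M * q g) := by
          gcongr
          exact hm η
      _ = _ := by ring
  · intro y
    have h2 : m y = ∫ η, Complex.exp (((2 * Real.pi * ⟪η, y⟫_ℝ : ℝ) : ℂ) * Complex.I) • m' η := by
      rw [← Real.fourierInv_eq', ← SchwartzMap.fourierInv_coe, hm',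
        FourierTransform.fourierInv_fourier_eq]
    rw [modulate_apply, mulSchwartz_apply, h2, mul_assoc, ← integral_mul_const]
    congr 1
    funext η
    rw [smul_apply, modulate_apply, inner_sub_right, real_inner_smul_right,
      smul_eq_mul, smul_eq_mul, real_inner_comm η y, mul_comm (cexp _) (m' η), mul_assoc,
      mul_left_comm (cexp _), ← Complex.exp_add]
    congr 3
    push_cast
    ring

/-- The dilated window `dilate b lam φ` as a Schwartz function. -/
def window (b lam : ℝ) (φ : 𝓢(Euc n, ℂ)) : 𝓢(Euc n, ℂ) :=
  if h : lam ^ b = 0 then 0 else ((lam ^ ((n : ℝ) * b / 2) : ℝ) : ℂ) •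
    SchwartzMap.compCLMOfContinuousLinearEquiv ℂ
      (ContinuousLinearEquiv.smulLeft (R₁ := ℝ) (Units.mk0 (lam ^ b) h) : Euc n ≃L[ℝ] Euc n) φ

lemma coe_window (b : ℝ) {lam : ℝ} (hlam : 1 ≤ lam) (φ : 𝓢(Euc n, ℂ)) :
    ⇑(window b lam φ) = dilate b lam φ := by
  have h : lam ^ b ≠ 0 := (Real.rpow_pos_of_pos (by linarith) b).ne'
  rw [window, dif_neg h]
  rfl

lemma WPTdist_dilate (u : 𝓢(Euc n, ℂ) →L[ℂ] ℂ) (b : ℝ) {lam : ℝ} (hlam : 1 ≤ lam)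
    (φ : 𝓢(Euc n, ℂ)) (x ζ : Euc n) :
    WPTdist u (dilate b lam φ) x ζ =
      u (modulate ζ ((conjSchwartz (window b lam φ)).compSubConstCLM ℂ x)) := by
  rw [WPTdist, ← coe_window b hlam]
  exact pairing_mul_exp u ((conjSchwartz (window b lam φ)).compSubConstCLM ℂ x) (fun y => rfl) ζ

lemma conjSchwartz_window (b : ℝ) {lam : ℝ} (hlam : 1 ≤ lam) (φ : 𝓢(Euc n, ℂ)) :
    conjSchwartz (window b lam φ) = window b lam (conjSchwartz φ) := by
  ext y
  rw [conjSchwartz_apply, coe_window b hlam, coe_window b hlam]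
  simp [dilate]

lemma norm_fourier_window_le (b : ℝ) (hb : 0 < b) (φ : 𝓢(Euc n, ℂ)) {lam : ℝ} (hlam : 1 ≤ lam)
    (x η : Euc n) : ‖(𝓕 ((window b lam φ).compSubConstCLM ℂ x) : 𝓢(Euc n, ℂ)) η‖ ≤
      ‖(𝓕 φ : 𝓢(Euc n, ℂ)) ((lam ^ b)⁻¹ • η)‖ := by
  set r := lam ^ b with hr
  have hr1 : 1 ≤ r := Real.one_le_rpow hlam hb.le
  have hr0 : 0 < r := by linarith
  have h1 : (𝓕 ((window b lam φ).compSubConstCLM ℂ x) : 𝓢(Euc n, ℂ)) η =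
      ((lam ^ ((n : ℝ) * b / 2) : ℝ) : ℂ) * (cexp (↑(-2 * Real.pi * ⟪x, η⟫_ℝ) * I) *
        ((r ^ n)⁻¹ • (𝓕 φ : 𝓢(Euc n, ℂ)) (r⁻¹ • η))) := by
    rw [SchwartzMap.fourier_coe, SchwartzMap.fourier_coe, Real.fourier_eq', Real.fourier_eq']
    set K : Euc n → ℂ := fun z => cexp (↑(-2 * Real.pi * ⟪z, r⁻¹ • η⟫_ℝ) * I) • φ z with hK
    have h2 : ∀ v, cexp (↑(-2 * Real.pi * ⟪v, η⟫_ℝ) * I) • (window b lam φ).compSubConstCLM ℂ x v =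
        ((lam ^ ((n : ℝ) * b / 2) : ℝ) : ℂ) * cexp (↑(-2 * Real.pi * ⟪x, η⟫_ℝ) * I) *
          K (r • (v - x)) := by
      intro v
      have h3 : ⟪v, η⟫_ℝ = ⟪x, η⟫_ℝ + ⟪r • (v - x), r⁻¹ • η⟫_ℝ := by
        rw [real_inner_smul_left, real_inner_smul_right, mul_inv_cancel_left₀ hr0.ne',
          inner_sub_left]
        ring
      rw [SchwartzMap.compSubConstCLM_apply, coe_window b hlam, dilate, hK, h3, mul_add,
        Complex.ofReal_add, add_mul, Complex.exp_add]
      simp only [smul_eq_mul]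
      ring
    simp only [h2]
    rw [integral_const_mul, integral_sub_right_eq_self (fun v => K (r • v)) x,
      Measure.integral_comp_smul, finrank_euclideanSpace_fin,
      abs_of_nonneg (by positivity), mul_assoc]
  rw [h1, norm_mul, norm_mul, Complex.norm_exp_ofReal_mul_I, one_mul, norm_smul, ← mul_assoc]
  refine mul_le_of_le_one_left (norm_nonneg _) ?_
  have hlam0 : 0 ≤ lam := by linarith
  rw [Complex.norm_real, Real.norm_of_nonneg (by positivity), Real.norm_of_nonneg (by positivity),
    ← div_eq_mul_inv, div_le_one (by positivity), hr, ← Real.rpow_natCast, ← Real.rpow_mul hlam0]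
  refine Real.rpow_le_rpow_of_exponent_le hlam ?_
  have : 0 ≤ (n : ℝ) * b := by positivity
  linarith

lemma scaledDecay_window {ι : Type*} {L : ι → ℝ} (hL : ∀ i, 1 ≤ L i) {b : ℝ} (hb : 0 < b)
    (φ : 𝓢(Euc n, ℂ)) (x : ι → Euc n) : ScaledDecay b L fun i =>
      ⇑(𝓕 ((window b (L i) φ).compSubConstCLM ℂ (x i)) : 𝓢(Euc n, ℂ)) := by
  intro k
  obtain ⟨C, hC, h⟩ := exists_pow_mul_norm_le (𝓕 φ : 𝓢(Euc n, ℂ)) k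
  refine ⟨C, hC, fun i η => ?_⟩
  set r := L i ^ b with hr
  have hr1 : 1 ≤ r := Real.one_le_rpow (hL i) hb.le
  have hr0 : 0 < r := by linarith
  calc _ ≤ ‖(𝓕 φ : 𝓢(Euc n, ℂ)) (r⁻¹ • η)‖ * (r * (1 + ‖r⁻¹ • η‖)) ^ k := by
        gcongr
        · exact norm_fourier_window_le b hb φ (hL i) (x i) η
        · rw [norm_smul, norm_inv, Real.norm_of_nonneg hr0.le, mul_add, mul_inv_cancel_left₀ hr0.ne']
          linarith
    _ = ‖(𝓕 φ : 𝓢(Euc n, ℂ)) (r⁻¹ • η)‖ * (1 + ‖r⁻¹ • η‖) ^ k * r ^ k := by rw [mul_pow]; ring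
    _ ≤ _ := by
        gcongr
        exact h _

lemma scaledDecay_const {ι : Type*} {L : ι → ℝ} (hL : ∀ i, 1 ≤ L i) {b : ℝ} (hb : 0 < b)
    (m : 𝓢(Euc n, ℂ)) : ScaledDecay b L fun _ => ⇑m := by
  intro k
  obtain ⟨C, hC, h⟩ := exists_pow_mul_norm_le m k
  exact ⟨C, hC, fun i η => (h η).trans
    (le_mul_of_one_le_right hC (one_le_pow₀ (Real.one_le_rpow (hL i) hb.le)))⟩

end Windows

section Remainder

open scoped ContDiff

lemma norm_iteratedFDeriv_comp_smul_le (f : 𝓢(Euc n, ℂ)) {r : ℝ} (hr : 1 ≤ r) (j : ℕ) (z : Euc n) :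
    ‖iteratedFDeriv ℝ j (fun z => f (r • z)) z‖ ≤ r ^ j * ‖iteratedFDeriv ℝ j f (r • z)‖ := by
  have h := ContinuousLinearMap.iteratedFDeriv_comp_right (r • ContinuousLinearMap.id ℝ (Euc n))
    (f.smooth j) z (i := j) le_rfl
  have h' : (f ∘ (r • ContinuousLinearMap.id ℝ (Euc n))) = fun z => f (r • z) := rfl
  rw [h'] at h
  rw [h]
  refine (ContinuousMultilinearMap.norm_compContinuousLinearMap_le _ _).trans ?_
  rw [Finset.prod_const, Finset.card_univ, Fintype.card_fin, mul_comm]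
  have hr0 : 0 ≤ r := by linarith
  refine mul_le_mul_of_nonneg_right (pow_le_pow_left₀ (norm_nonneg _) ?_ j) (norm_nonneg _)
  refine (norm_smul_le _ _).trans ?_
  rw [Real.norm_of_nonneg hr0]
  exact mul_le_of_le_one_right hr0 ContinuousLinearMap.norm_id_le

lemma exists_seminorm_cutoff_scale_le (f : 𝓢(Euc n, ℂ)) (B : ℕ → ℝ) (k l N : ℕ) :
    ∃ C : ℝ, 0 ≤ C ∧ ∀ (κ : Euc n → ℂ) (r δ : ℝ) (h : 𝓢(Euc n, ℂ)), 1 ≤ r → 0 ≤ δ →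
      ContDiff ℝ ∞ κ → (∀ j z, ‖iteratedFDeriv ℝ j κ z‖ ≤ B j) → (∀ z, ‖z‖ < δ → κ z = 0) →
      (∀ z, h z = κ z * f (r • z)) →
      SchwartzMap.seminorm ℂ k l h * (r * δ) ^ N ≤ C * r ^ l := by
  set C := ∑ j ∈ Finset.range (l + 1), (l.choose j : ℝ) * |B j| *
    SchwartzMap.seminorm ℂ (k + N) (l - j) f with hC
  have hC0 : 0 ≤ C := Finset.sum_nonneg fun j _ => by positivity
  refine ⟨C, hC0, fun κ r δ h hr hδ hκ hB hκ0 hh => ?_⟩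
  have hr0 : 0 < r := by linarith
  rcases (by positivity : 0 ≤ (r * δ) ^ N).eq_or_lt with h0 | hpos
  · rw [← h0, mul_zero]
    positivity
  rw [← le_div_iff₀ hpos]
  refine SchwartzMap.seminorm_le_bound ℂ k l h (by positivity) fun z => ?_
  rw [le_div_iff₀ hpos]
  have hfun : ⇑h = fun z => κ z * f (r • z) := funext hh
  rcases lt_or_ge ‖z‖ δ with hz | hz
  · have hloc : ⇑h =ᶠ[nhds z] fun _ => 0 := by
      filter_upwards [(isOpen_lt continuous_norm continuous_const).mem_nhds hz] with y hy
      rw [hh, hκ0 y hy, zero_mul]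
    rw [(hloc.iteratedFDeriv ℝ l).eq_of_nhds]
    simp only [iteratedFDeriv_fun_zero, Pi.zero_apply, norm_zero, mul_zero, zero_mul]
    positivity
  · have hf : ContDiff ℝ ∞ fun z => f (r • z) := (f.smooth ⊤).comp (contDiff_const_smul r)
    have hleib : ‖iteratedFDeriv ℝ l h z‖ ≤ ∑ j ∈ Finset.range (l + 1), (l.choose j : ℝ) * |B j| *
        (r ^ l * ‖iteratedFDeriv ℝ (l - j) f (r • z)‖) := by
      rw [hfun]
      refine (norm_iteratedFDeriv_mul_le hκ hf z (mod_cast le_top)).trans ?_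
      refine Finset.sum_le_sum fun j hj => ?_
      gcongr
      · exact (hB j z).trans (le_abs_self _)
      · refine (norm_iteratedFDeriv_comp_smul_le f hr _ z).trans ?_
        gcongr
        omega
    have hpow : ‖z‖ ^ k * (r * δ) ^ N ≤ ‖r • z‖ ^ (k + N) := by
      rw [norm_smul, Real.norm_of_nonneg hr0.le, pow_add]
      gcongr
      exact le_mul_of_one_le_left (norm_nonneg _) hr
    calc ‖z‖ ^ k * ‖iteratedFDeriv ℝ l h z‖ * (r * δ) ^ N
        = (‖z‖ ^ k * (r * δ) ^ N) * ‖iteratedFDeriv ℝ l h z‖ := by ring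
      _ ≤ ‖r • z‖ ^ (k + N) * ∑ j ∈ Finset.range (l + 1), (l.choose j : ℝ) * |B j| *
        (r ^ l * ‖iteratedFDeriv ℝ (l - j) f (r • z)‖) := by gcongr
      _ = ∑ j ∈ Finset.range (l + 1), (l.choose j : ℝ) * |B j| *
        (‖r • z‖ ^ (k + N) * ‖iteratedFDeriv ℝ (l - j) f (r • z)‖) * r ^ l := by
          rw [Finset.mul_sum]
          exact Finset.sum_congr rfl fun j _ => by ring
      _ ≤ C * r ^ l := by
          rw [hC, Finset.sum_mul]
          refine Finset.sum_le_sum fun j _ => ?_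
          gcongr
          exact f.le_seminorm ℂ (k + N) (l - j) (r • z)

/-- Cutting a window off near its centre makes it rapidly small in the scale, even after
translation and modulation. -/
lemma exists_cutoff_window_le {b : ℝ} (hb : 0 < b) (f : 𝓢(Euc n, ℂ)) (B : ℕ → ℝ)
    {q : Seminorm ℂ 𝓢(Euc n, ℂ)} (hq : Continuous q) :
    ∃ M : ℕ, ∀ N : ℕ, ∃ C : ℝ, 0 ≤ C ∧ ∀ (κ : Euc n → ℂ) (lam δ : ℝ) (x ζ : Euc n)
      (h : 𝓢(Euc n, ℂ)), 1 ≤ lam → 0 ≤ δ →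
      ContDiff ℝ ∞ κ → (∀ j z, ‖iteratedFDeriv ℝ j κ z‖ ≤ B j) → (∀ z, ‖z‖ < δ → κ z = 0) →
      (∀ z, h z = κ z * window b lam f z) →
      q (modulate ζ (h.compSubConstCLM ℂ x)) * (lam ^ b * δ) ^ N ≤
        C * ((1 + ‖ζ‖) * (1 + ‖x‖) * lam ^ b) ^ M := by
  have hw : ∀ p : Euc n × Euc n, 1 ≤ (1 + ‖p.1‖) * (1 + ‖p.2‖) := fun p =>
    one_le_mul_of_one_le_of_one_le (by simp) (by simp)
  have hT : PolyBounded (fun p : Euc n × Euc n => (1 + ‖p.1‖) * (1 + ‖p.2‖))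
      fun p => modulate p.1 ∘L SchwartzMap.compSubConstCLM ℂ p.2 := by
    refine .comp hw ?_ ?_
    · refine (polyBounded_modulate.comp_index Prod.fst).mono (fun p => by positivity) fun p => ?_
      exact le_mul_of_one_le_right (by positivity) (by simp)
    · refine (polyBounded_compSubConst.comp_index Prod.snd).mono (fun p => by positivity) fun p => ?_
      exact le_mul_of_one_le_left (by positivity) (by simp)
  obtain ⟨q', hq', M, hM⟩ := hT q hq
  obtain ⟨s, A, hA, hs⟩ := exists_le_sum_seminorm hq'
  choose D hD0 hD using exists_seminorm_cutoff_scale_le f B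
  set m := ∑ i ∈ s, i.2 with hm
  refine ⟨M + (n + m), fun N => ⟨A * ∑ i ∈ s, D i.1 i.2 N,
    mul_nonneg hA (Finset.sum_nonneg fun i _ => hD0 _ _ _), ?_⟩⟩
  intro κ lam δ x ζ h hlam hδ hκ hB hκ0 hh
  set r := lam ^ b with hr
  have hr1 : 1 ≤ r := Real.one_le_rpow hlam hb.le
  have hr0 : 0 < r := by linarith
  have hlam0 : 0 < lam := by linarith
  set c := lam ^ ((n : ℝ) * b / 2) with hc
  have hc0 : 0 < c := Real.rpow_pos_of_pos hlam0 _
  have hcr : c ≤ r ^ n := by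
    rw [hc, hr, ← Real.rpow_natCast, ← Real.rpow_mul hlam0.le]
    refine Real.rpow_le_rpow_of_exponent_le hlam ?_
    have : 0 ≤ (n : ℝ) * b := by positivity
    linarith
  set h' : 𝓢(Euc n, ℂ) := (c : ℂ)⁻¹ • h with hh'
  have hhc : h = (c : ℂ) • h' := by
    rw [hh', smul_smul, mul_inv_cancel₀ (by exact_mod_cast hc0.ne'), one_smul]
  have hh'z : ∀ z, h' z = κ z * f (r • z) := by
    intro z
    rw [hh', smul_apply, hh, coe_window b hlam, dilate, smul_eq_mul, mul_left_comm (κ z),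
      inv_mul_cancel_left₀ (by exact_mod_cast hc0.ne')]
  have hq'h : q' h' * (r * δ) ^ N ≤ (A * ∑ i ∈ s, D i.1 i.2 N) * r ^ m := by
    calc _ ≤ (A * ∑ i ∈ s, SchwartzMap.seminorm ℂ i.1 i.2 h') * (r * δ) ^ N := by
          gcongr
          exact hs h'
      _ = A * ∑ i ∈ s, SchwartzMap.seminorm ℂ i.1 i.2 h' * (r * δ) ^ N := by
          rw [mul_assoc, Finset.sum_mul]
      _ ≤ A * ∑ i ∈ s, D i.1 i.2 N * r ^ m := by
          refine mul_le_mul_of_nonneg_left (Finset.sum_le_sum fun i hi => ?_) hA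
          refine (hD i.1 i.2 N κ r δ h' hr1 hδ hκ hB hκ0 hh'z).trans ?_
          refine mul_le_mul_of_nonneg_left (pow_le_pow_right₀ hr1 ?_) (hD0 _ _ _)
          exact Finset.single_le_sum (f := fun i : ℕ × ℕ => i.2) (fun _ _ => Nat.zero_le _) hi
      _ = _ := by rw [← Finset.sum_mul, mul_assoc]
  have hqh : q' h = c * q' h' := by
    rw [hhc, map_smul_eq_mul, Complex.norm_real, Real.norm_of_nonneg hc0.le]
  have hS : 0 ≤ A * ∑ i ∈ s, D i.1 i.2 N :=
    mul_nonneg hA (Finset.sum_nonneg fun i _ => hD0 _ _ _)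
  set S := A * ∑ i ∈ s, D i.1 i.2 N
  set w := (1 + ‖ζ‖) * (1 + ‖x‖) with hwdef
  have hw1 : 1 ≤ w := hw (ζ, x)
  have hw0 : 0 ≤ w := by linarith
  calc _ ≤ (w ^ M * q' h) * (r * δ) ^ N := by
        gcongr
        exact hM (ζ, x) h
    _ = w ^ M * c * (q' h' * (r * δ) ^ N) := by rw [hqh]; ring
    _ ≤ w ^ M * r ^ n * (S * r ^ m) := by gcongr
    _ = S * (w ^ M * r ^ (n + m)) := by rw [pow_add]; ring
    _ ≤ S * ((w * r) ^ M * (w * r) ^ (n + m)) := by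
        gcongr
        · exact le_mul_of_one_le_right hw0 hr1
        · exact le_mul_of_one_le_left hr0.le hw1
    _ = _ := by rw [pow_add _ M (n + m)]

end Remainder

section Rapid

open scoped ContDiff

lemma exists_cutoff_window_rapid {b : ℝ} (hb : 0 < b) (hb1 : b < 1) (f : 𝓢(Euc n, ℂ)) (B : ℕ → ℝ)
    {q : Seminorm ℂ 𝓢(Euc n, ℂ)} (hq : Continuous q) {ε : ℝ} (hε : 0 < ε) (N k : ℕ) {a : ℝ}
    (ha : 1 ≤ a) :
    ∃ C : ℝ, 0 ≤ C ∧ ∀ (κ : Euc n → ℂ) (lam δ : ℝ) (x ξ : Euc n)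
      (h : 𝓢(Euc n, ℂ)), 1 ≤ lam → ε * (1 + ‖x‖) ≤ δ →
      ContDiff ℝ ∞ κ → (∀ j z, ‖iteratedFDeriv ℝ j κ z‖ ≤ B j) → (∀ z, ‖z‖ < δ → κ z = 0) →
      (∀ z, h z = κ z * window b lam f z) → ‖ξ‖ ≤ a →
      q (modulate (lam • ξ) (h.compSubConstCLM ℂ x)) * lam ^ N * (1 + ‖x‖) ^ k ≤ C := by
  obtain ⟨M, hM⟩ := exists_cutoff_window_le hb f B hq
  obtain ⟨p₀, hp₀⟩ := exists_nat_ge ((N + 2 * M : ℕ) / b)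
  set p := p₀ + (M + k)
  have hp : ((N + 2 * M : ℕ) : ℝ) ≤ b * p := by
    rw [div_le_iff₀ hb] at hp₀
    refine hp₀.trans ?_
    rw [mul_comm]
    gcongr
    simp [p]
  obtain ⟨C, hC, hq⟩ := hM p
  refine ⟨C * (2 * a) ^ M / ε ^ p, by positivity, ?_⟩
  intro κ lam δ x ξ h hlam hδ hκ hB hκ0 hh hξ
  have hδ0 : 0 ≤ δ := le_trans (by positivity) hδ
  have hlam0 : 0 < lam := by linarith
  have hx1 : 1 ≤ 1 + ‖x‖ := by simp
  have key := hq κ lam δ x (lam • ξ) h hlam hδ0 hκ hB hκ0 hh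
  set Q := q (modulate (lam • ξ) (h.compSubConstCLM ℂ x)) with hQ
  have hQ0 : 0 ≤ Q := apply_nonneg _ _
  have hlb : lam ^ b ≤ lam := by
    simpa using Real.rpow_le_rpow_of_exponent_le hlam hb1.le
  have hlbp : lam ^ (N + 2 * M) ≤ (lam ^ b) ^ p := by
    rw [← Real.rpow_natCast, ← Real.rpow_natCast, ← Real.rpow_mul hlam0.le]
    exact Real.rpow_le_rpow_of_exponent_le hlam hp
  have hζ : 1 + ‖lam • ξ‖ ≤ 2 * a * lam := by
    rw [norm_smul, Real.norm_of_nonneg hlam0.le]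
    nlinarith
  rw [le_div_iff₀ (by positivity)]
  have hpos : 0 < lam ^ (2 * M) * (1 + ‖x‖) ^ M := by positivity
  refine le_of_mul_le_mul_right ?_ hpos
  calc Q * lam ^ N * (1 + ‖x‖) ^ k * ε ^ p * (lam ^ (2 * M) * (1 + ‖x‖) ^ M)
      = Q * (lam ^ (N + 2 * M) * (ε ^ p * (1 + ‖x‖) ^ (M + k))) := by ring
    _ ≤ Q * ((lam ^ b) ^ p * (ε ^ p * (1 + ‖x‖) ^ p)) := by
        gcongr
        simp [p]
    _ = Q * (lam ^ b * (ε * (1 + ‖x‖))) ^ p := by rw [mul_pow, mul_pow]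
    _ ≤ Q * (lam ^ b * δ) ^ p := by gcongr
    _ ≤ _ := key
    _ ≤ C * ((2 * a * lam) * (1 + ‖x‖) * lam) ^ M := by gcongr
    _ = _ := by
        simp only [mul_pow]
        ring

/-- The continuous seminorm `f ↦ ‖u f‖`. -/
def normSeminormComp (u : 𝓢(Euc n, ℂ) →L[ℂ] ℂ) : Seminorm ℂ 𝓢(Euc n, ℂ) :=
  (normSeminorm ℂ ℂ).comp u.toLinearMap

lemma normSeminormComp_apply (u : 𝓢(Euc n, ℂ) →L[ℂ] ℂ) (f : 𝓢(Euc n, ℂ)) :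
    normSeminormComp u f = ‖u f‖ := rfl

lemma continuous_normSeminormComp (u : 𝓢(Euc n, ℂ) →L[ℂ] ℂ) : Continuous (normSeminormComp u) :=
  continuous_norm.comp u.continuous

lemma norm_iteratedFDeriv_one_le (j : ℕ) (z : Euc n) :
    ‖iteratedFDeriv ℝ j (fun _ : Euc n => (1 : ℂ)) z‖ ≤ 1 := by
  rcases eq_or_ne j 0 with rfl | hj
  · simp
  · rw [iteratedFDeriv_const_of_ne hj]
    simp

lemma norm_iteratedFDeriv_comp_add_le (χ : 𝓢(Euc n, ℂ)) (x : Euc n) (j : ℕ) (z : Euc n) :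
    ‖iteratedFDeriv ℝ j (fun z => χ (z + x)) z‖ ≤ SchwartzMap.seminorm ℂ 0 j χ := by
  rw [iteratedFDeriv_comp_add_right]
  simpa using χ.le_seminorm ℂ 0 j (z + x)

lemma contDiff_comp_add (χ : 𝓢(Euc n, ℂ)) (x : Euc n) : ContDiff ℝ ∞ fun z => χ (z + x) :=
  (χ.smooth ⊤).comp (contDiff_id.add contDiff_const)

variable {ι : Type*} {L : ι → ℝ} {b : ℝ}

lemma polyGrowth_window (hb : 0 < b) (hb1 : b < 1) (hL : ∀ i, 1 ≤ L i)
    (u : 𝓢(Euc n, ℂ) →L[ℂ] ℂ) (f : 𝓢(Euc n, ℂ)) {x : ι → Euc n} {R : ℝ} (hx : ∀ i, ‖x i‖ ≤ R) :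
    PolyGrowth L fun i ζ => u (modulate ζ ((window b (L i) f).compSubConstCLM ℂ (x i))) := by
  obtain ⟨M, hM⟩ := exists_cutoff_window_le hb f (fun _ => 1) (continuous_normSeminormComp u)
  obtain ⟨C, hC, h⟩ := hM 0
  refine ⟨C * (1 + |R|) ^ M, M, by positivity, fun i ζ => ?_⟩
  have hLi := hL i
  have hlb : L i ^ b ≤ L i := by
    simpa using Real.rpow_le_rpow_of_exponent_le hLi hb1.le
  have := h (fun _ => 1) (L i) 0 (x i) ζ (window b (L i) f) hLi le_rfl contDiff_const
    norm_iteratedFDeriv_one_le (fun z hz => absurd hz (norm_nonneg z).not_gt) (by simp)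
  rw [pow_zero, mul_one, normSeminormComp_apply] at this
  refine this.trans ?_
  rw [mul_assoc C, ← mul_pow]
  have hR : ‖x i‖ ≤ |R| := (hx i).trans (le_abs_self R)
  have : (1 + ‖ζ‖) * (1 + ‖x i‖) * L i ^ b ≤ (1 + |R|) * (L i * (1 + ‖ζ‖)) := by
    calc _ ≤ (1 + ‖ζ‖) * (1 + |R|) * L i := by gcongr
      _ = _ := by ring
  gcongr

variable {u : 𝓢(Euc n, ℂ) →L[ℂ] ℂ} {m g : ι → 𝓢(Euc n, ℂ)}

lemma PolyGrowth.mulSchwartz (hL : ∀ i, 1 ≤ L i) (hb1 : b < 1)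
    (hg : PolyGrowth L fun i ζ => u (modulate ζ (g i)))
    (hm : ScaledDecay b L fun i => ⇑(𝓕 (m i) : 𝓢(Euc n, ℂ))) :
    PolyGrowth L fun i ζ => u (modulate ζ (mulSchwartz (m i) (g i))) := by
  simp only [apply_modulate_mulSchwartz]
  exact hg.convolution hL hb1 hm

lemma RapidOn.mulSchwartz {Γ Γ' : Set (Euc n)} (hL : ∀ i, 1 ≤ L i) (hb1 : b < 1)
    (hg : PolyGrowth L fun i ζ => u (modulate ζ (g i)))
    (hg' : RapidOn L (fun i ζ => u (modulate ζ (g i))) Γ) (hΓ : WellInside Γ' Γ)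
    (hm : ScaledDecay b L fun i => ⇑(𝓕 (m i) : 𝓢(Euc n, ℂ))) :
    RapidOn L (fun i ζ => u (modulate ζ (mulSchwartz (m i) (g i)))) Γ' := by
  simp only [apply_modulate_mulSchwartz]
  exact hg'.convolution hL hb1 hg hΓ hm

lemma polyGrowth_modulate (hL : ∀ i, 1 ≤ L i) (u : 𝓢(Euc n, ℂ) →L[ℂ] ℂ) (f : 𝓢(Euc n, ℂ)) :
    PolyGrowth L fun _ ζ => u (modulate ζ f) := by
  obtain ⟨q, -, M, h⟩ := polyBounded_modulate.norm_apply_le u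
  refine ⟨q f, M, apply_nonneg _ _, fun i ζ => (h ζ f).trans ?_⟩
  rw [mul_comm]
  gcongr
  exact le_mul_of_one_le_left (by positivity) (hL i)

end Rapid

section Direct

open scoped ContDiff

lemma exists_schwartz_eq_ofReal {χ : Euc n → ℝ} (hχ : ContDiff ℝ ∞ χ) (hs : HasCompactSupport χ) :
    ∃ X : 𝓢(Euc n, ℂ), ∀ y, X y = χ y :=
  ⟨HasCompactSupport.toSchwartzMap (hs.comp_left (g := ((↑) : ℝ → ℂ)) (by simp))
    (Complex.ofRealCLM.contDiff.comp hχ), fun _ => rfl⟩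

lemma exists_mul_eq_one_near {χ : Euc n → ℝ} (hχ : ContDiff ℝ ∞ χ) {x₀ : Euc n} (h : χ x₀ ≠ 0) :
    ∃ m ρ : 𝓢(Euc n, ℂ), (∀ y, ρ y = m y * χ y) ∧
      ∃ δ : ℝ, 0 < δ ∧ ∀ y, ‖y - x₀‖ < 2 * δ → ρ y = 1 := by
  obtain ⟨R, hR, hball⟩ := Metric.nhds_basis_closedBall.mem_iff.1
    (hχ.continuous.continuousAt.eventually_ne h)
  let f : ContDiffBump x₀ := ⟨R / 2, R, by positivity, by linarith⟩
  have hdiv : ContDiff ℝ ∞ fun y => f y / χ y := by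
    refine contDiff_iff_contDiffAt.2 fun y => ?_
    by_cases hy : y ∈ tsupport f
    · rw [f.tsupport_eq] at hy
      exact f.contDiffAt.div hχ.contDiffAt (hball hy)
    · have : (fun y => f y / χ y) =ᶠ[nhds y] fun _ => 0 := by
        filter_upwards [notMem_tsupport_iff_eventuallyEq.1 hy] with z hz
        simp [hz]
      exact contDiffAt_const.congr_of_eventuallyEq this
  have hsupp : HasCompactSupport fun y => f y / χ y := by
    simp only [div_eq_mul_inv]
    exact f.hasCompactSupport.mul_right
  obtain ⟨m, hm⟩ := exists_schwartz_eq_ofReal hdiv hsupp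
  obtain ⟨ρ, hρ⟩ := exists_schwartz_eq_ofReal f.contDiff f.hasCompactSupport
  refine ⟨m, ρ, fun y => ?_, R / 4, by positivity, fun y hy => ?_⟩
  · rw [hm, hρ, ← Complex.ofReal_mul]
    congr 1
    by_cases hy : χ y = 0
    · have : ¬ y ∈ Metric.closedBall x₀ R := fun hy' => hball hy' hy
      rw [hy, mul_zero, f.zero_of_le_dist (not_le.1 this).le]
    · rw [div_mul_cancel₀ _ hy]
  · rw [hρ, f.one_of_mem_closedBall, Complex.ofReal_one]
    rw [mem_closedBall_iff_norm]
    exact hy.le.trans (by simp only [f]; linarith)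

lemma norm_le_mul_rpow_neg {z : ℂ} {C lam : ℝ} (hlam : 0 < lam) {N : ℕ} (h : ‖z‖ * lam ^ N ≤ C) :
    ‖z‖ ≤ (C + 1) * lam ^ (-(N : ℝ)) := by
  rw [Real.rpow_neg hlam.le, Real.rpow_natCast, ← div_eq_mul_inv, le_div_iff₀ (by positivity)]
  linarith

lemma rapidOn_of_fourier_decay {ι : Type*} {L : ι → ℝ} (hL : ∀ i, 1 ≤ L i) {G : Euc n → ℂ}
    {Γ : Set (Euc n)} (hΓ : ∀ ξ ∈ Γ, ∀ c : ℝ, 0 < c → c • ξ ∈ Γ)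
    (h : ∀ N : ℕ, ∃ C : ℝ, 0 < C ∧ ∀ ξ ∈ Γ, ‖G ξ‖ ≤ C * (1 + ‖ξ‖) ^ (-(N : ℝ))) :
    RapidOn L (fun _ => G) Γ := by
  intro N a ha
  have ha0 : 0 < a := by linarith
  obtain ⟨C, hC, h⟩ := h N
  refine ⟨C * a ^ N, by positivity, fun i ξ hξ h1 _ => ?_⟩
  have hL0 : 0 < L i := by linarith [hL i]
  have h2 := h _ (hΓ ξ hξ _ hL0)
  rw [Real.rpow_neg (by positivity), Real.rpow_natCast, ← div_eq_mul_inv,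
    le_div_iff₀ (by positivity)] at h2
  have h3 : L i ≤ a * (1 + ‖L i • ξ‖) := by
    rw [norm_smul, Real.norm_of_nonneg hL0.le]
    have : 1 ≤ a * ‖ξ‖ := by rwa [inv_le_iff_one_le_mul₀' ha0] at h1
    nlinarith
  calc ‖G (L i • ξ)‖ * L i ^ N ≤ ‖G (L i • ξ)‖ * (a * (1 + ‖L i • ξ‖)) ^ N := by gcongr
    _ = ‖G (L i • ξ)‖ * (1 + ‖L i • ξ‖) ^ N * a ^ N := by rw [mul_pow]; ring
    _ ≤ C * a ^ N := by gcongr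

/-- Off the wave front set, wave packet transforms with arbitrary dilated windows decay rapidly. -/
lemma NotInWFdist.exists_wavePacket_decay {b : ℝ} (hb0 : 0 < b) (hb1 : b < 1)
    {u : 𝓢(Euc n, ℂ) →L[ℂ] ℂ} {x₀ ξ₀ : Euc n} (hWF : NotInWFdist u x₀ ξ₀) :
    ∃ K Γ : Set (Euc n), K ∈ nhds x₀ ∧ IsConicNbhd Γ ξ₀ ∧
      ∀ φ : 𝓢(Euc n, ℂ), ∀ N : ℕ, ∀ a : ℝ, 1 ≤ a → ∃ C : ℝ, 0 < C ∧
        ∀ lam : ℝ, 1 ≤ lam → ∀ x ∈ K, ∀ ξ ∈ Γ, a⁻¹ ≤ ‖ξ‖ → ‖ξ‖ ≤ a →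
          ‖WPTdist u (dilate b lam ⇑φ) x (lam • ξ)‖ ≤ C * lam ^ (-(N : ℝ)) := by
  obtain ⟨χ, hχ, hχs, hχ0, Γ₀, hΓ₀, hdecay⟩ := hWF
  obtain ⟨X, hX⟩ := exists_schwartz_eq_ofReal hχ hχs
  obtain ⟨m, ρ, hmρ, δ, hδ, hρ⟩ := exists_mul_eq_one_near hχ hχ0
  obtain ⟨Γ₁, hΓ₁, hΓ₁₀⟩ := hΓ₀.exists_wellInside
  obtain ⟨Γ₂, hΓ₂, hΓ₂₁⟩ := hΓ₁.exists_wellInside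
  refine ⟨Metric.ball x₀ δ, Γ₂, Metric.ball_mem_nhds x₀ hδ, hΓ₂, fun φ N a ha => ?_⟩
  let L : {p : ℝ × Euc n // 1 ≤ p.1} → ℝ := fun i => i.1.1
  have hL : ∀ i, 1 ≤ L i := fun i => i.2
  have hX0 : RapidOn L (fun _ ζ => u (modulate ζ X)) Γ₀ := by
    refine rapidOn_of_fourier_decay hL hΓ₀.2 fun N => ?_
    obtain ⟨C, hC, h⟩ := hdecay N
    refine ⟨C, hC, fun ξ hξ => ?_⟩
    rw [← pairing_mul_exp u X (fun y => (hX y).symm)]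
    exact h ξ hξ
  have hXp := polyGrowth_modulate hL u X
  have hm := scaledDecay_const hL hb0 (𝓕 m : 𝓢(Euc n, ℂ))
  have hw := scaledDecay_window hL hb0 (conjSchwartz φ) fun i => i.1.2
  obtain ⟨C₁, hC₁, hmain⟩ := RapidOn.mulSchwartz hL hb1 (hXp.mulSchwartz hL hb1 hm)
    (hX0.mulSchwartz hL hb1 hXp hΓ₁₀ hm) hΓ₂₁ hw N a ha
  set ε := δ / (1 + ‖x₀‖ + δ) with hε
  obtain ⟨C₂, hC₂, hrem⟩ := exists_cutoff_window_rapid hb0 hb1 (conjSchwartz φ)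
    (fun j => 1 + SchwartzMap.seminorm ℂ 0 j ρ) (continuous_normSeminormComp u)
    (by positivity : 0 < ε) N 0 ha
  refine ⟨C₁ + C₂ + 1, by positivity, fun lam hlam x hx ξ hξ h1 h2 => ?_⟩
  refine norm_le_mul_rpow_neg (by linarith) ?_
  rw [WPTdist_dilate u b hlam, conjSchwartz_window b hlam]
  set W := window b lam (conjSchwartz φ) with hW
  set h : 𝓢(Euc n, ℂ) := W - mulSchwartz (ρ.compSubConstCLM ℂ (-x)) W with hh
  have hhz : ∀ z, h z = (1 - ρ (z + x)) * W z := by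
    intro z
    rw [hh, sub_apply, mulSchwartz_apply, SchwartzMap.compSubConstCLM_apply, sub_neg_eq_add]
    ring
  have hsplit : W.compSubConstCLM ℂ x =
      mulSchwartz (W.compSubConstCLM ℂ x) (mulSchwartz m X) + h.compSubConstCLM ℂ x := by
    ext y
    rw [add_apply, mulSchwartz_apply, mulSchwartz_apply, hX, ← hmρ,
      SchwartzMap.compSubConstCLM_apply, SchwartzMap.compSubConstCLM_apply, hhz, sub_add_cancel]
    ring
  rw [hsplit, map_add, map_add]
  have e1 := hmain ⟨(lam, x), hlam⟩ ξ hξ h1 h2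
  rw [mem_ball_iff_norm] at hx
  have e2 := hrem (fun z => 1 - ρ (z + x)) lam δ x ξ h hlam ?_
    (contDiff_const.sub (contDiff_comp_add ρ x)) ?_ ?_ hhz h2
  · rw [pow_zero, mul_one, normSeminormComp_apply] at e2
    have : 0 ≤ lam ^ N := by positivity
    calc _ ≤ (‖u (modulate (lam • ξ) (mulSchwartz (W.compSubConstCLM ℂ x) (mulSchwartz m X)))‖ +
          ‖u (modulate (lam • ξ) (h.compSubConstCLM ℂ x))‖) * lam ^ N := by
          gcongr
          exact norm_add_le _ _
      _ ≤ C₁ + C₂ := by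
          rw [add_mul]
          exact add_le_add e1 e2
  · rw [hε, div_mul_eq_mul_div, div_le_iff₀ (by positivity)]
    refine mul_le_mul_of_nonneg_left ?_ hδ.le
    have := norm_add_le x₀ (x - x₀)
    rw [add_sub_cancel] at this
    linarith
  · intro j z
    have := iteratedFDeriv_sub (i := j) (𝕜 := ℝ) (f := fun _ : Euc n => (1 : ℂ))
      (g := fun z => ρ (z + x)) contDiff_const (contDiff_infty.1 (contDiff_comp_add ρ x) j)
    rw [show (fun z => 1 - ρ (z + x)) = (fun _ : Euc n => (1 : ℂ)) - fun z => ρ (z + x) from rfl,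
      this]
    exact (norm_sub_le _ _).trans
      (add_le_add (norm_iteratedFDeriv_one_le j z) (norm_iteratedFDeriv_comp_add_le ρ x j z))
  · intro z hz
    rw [hρ, sub_self]
    rw [add_sub_assoc]
    linarith [norm_add_le z (x - x₀)]

end Direct

section Converse

open scoped ContDiff

variable {b : ℝ} {X : 𝓢(Euc n, ℂ)} {x₀ : Euc n} {δ : ℝ}

lemma exists_mul_window_far_le (hb0 : 0 < b) (hb1 : b < 1) (hδ : 0 < δ)
    (hX : ∀ y, δ ≤ ‖y - x₀‖ → X y = 0) (f : 𝓢(Euc n, ℂ)) {q : Seminorm ℂ 𝓢(Euc n, ℂ)}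
    (hq : Continuous q) (N k : ℕ) {a : ℝ} (ha : 1 ≤ a) :
    ∃ C : ℝ, 0 ≤ C ∧ ∀ lam : ℝ, 1 ≤ lam → ∀ x, 2 * δ ≤ ‖x - x₀‖ → ∀ ξ, ‖ξ‖ ≤ a →
      q (modulate (lam • ξ) (mulSchwartz X ((window b lam f).compSubConstCLM ℂ x))) * lam ^ N *
        (1 + ‖x‖) ^ k ≤ C := by
  set ε := δ / (1 + ‖x₀‖ + 2 * δ) with hε
  obtain ⟨C, hC, h⟩ := exists_cutoff_window_rapid hb0 hb1 f
    (fun j => SchwartzMap.seminorm ℂ 0 j X) hq (by positivity : 0 < ε) N k ha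
  refine ⟨C, hC, fun lam hlam x hx ξ hξ => ?_⟩
  have key := h (fun z => X (z + x)) lam (‖x - x₀‖ / 2) x ξ
    (mulSchwartz (X.compSubConstCLM ℂ (-x)) (window b lam f)) hlam ?_ (contDiff_comp_add X x)
    (norm_iteratedFDeriv_comp_add_le X x) ?_ ?_ hξ
  · have hτ : mulSchwartz X ((window b lam f).compSubConstCLM ℂ x) =
        (mulSchwartz (X.compSubConstCLM ℂ (-x)) (window b lam f)).compSubConstCLM ℂ x := by
      ext y
      simp
    rwa [hτ]
  · rw [hε, div_mul_eq_mul_div, div_le_iff₀ (by positivity)]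
    have h1 := norm_add_le x₀ (x - x₀)
    rw [add_sub_cancel] at h1
    nlinarith [norm_nonneg x₀]
  · intro z hz
    refine hX _ ?_
    have h1 := norm_sub_le (z + x - x₀) z
    rw [show z + x - x₀ - z = x - x₀ by abel] at h1
    linarith
  · intro z
    simp

lemma integral_mul_apply_modulate (hb0 : 0 < b) (hb1 : b < 1) (hδ : 0 < δ)
    (hX : ∀ y, δ ≤ ‖y - x₀‖ → X y = 0) (u : 𝓢(Euc n, ℂ) →L[ℂ] ℂ) (f : 𝓢(Euc n, ℂ)) {lam : ℝ}
    (hlam : 1 ≤ lam) (ζ : Euc n) :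
    (∫ z, window b lam f z) * u (modulate ζ X) =
      ∫ x, u (modulate ζ (mulSchwartz X ((window b lam f).compSubConstCLM ℂ x))) := by
  have hlam0 : lam ≠ 0 := by linarith
  set F : Euc n → 𝓢(Euc n, ℂ) := fun x =>
    modulate ζ (mulSchwartz X ((window b lam f).compSubConstCLM ℂ x)) with hF
  have hFc : Continuous F := (modulate ζ).continuous.comp
    ((mulSchwartz X).continuous.comp (continuous_compSubConst (window b lam f)))
  rw [← smul_eq_mul, ← map_smul]
  refine tempered_integral_comm u hFc (fun k l => ?_) fun y => ?_
  · have hc : Continuous fun x => SchwartzMap.seminorm ℂ k l (F x) * (1 + ‖x‖) ^ (n + 1) :=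
      ((continuous_seminorm k l).comp hFc).mul (by fun_prop)
    obtain ⟨C₁, hC₁⟩ := (isCompact_closedBall x₀ (2 * δ)).exists_bound_of_continuousOn
      hc.continuousOn
    obtain ⟨C₂, -, hC₂⟩ := exists_mul_window_far_le hb0 hb1 hδ hX f (continuous_seminorm k l) 0
      (n + 1) (le_max_left 1 ‖lam⁻¹ • ζ‖)
    refine (integrable_inv_one_add_norm_pow.const_mul (max C₁ C₂)).mono'
      ((continuous_seminorm k l).comp hFc).aestronglyMeasurable
      (Filter.Eventually.of_forall fun x => ?_)
    rw [Real.norm_of_nonneg (apply_nonneg _ _), ← div_eq_mul_inv, le_div_iff₀ (by positivity)]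
    rcases le_total ‖x - x₀‖ (2 * δ) with hx | hx
    · exact ((le_abs_self _).trans (hC₁ x (mem_closedBall_iff_norm.2 hx))).trans (le_max_left _ _)
    · have := hC₂ lam hlam x hx _ (le_max_right _ _)
      rw [smul_inv_smul₀ hlam0, pow_zero, mul_one] at this
      exact this.trans (le_max_right _ _)
  · simp only [hF, smul_apply, modulate_apply, mulSchwartz_apply,
      SchwartzMap.compSubConstCLM_apply, smul_eq_mul]
    rw [← integral_sub_left_eq_self (fun z => window b lam f z) volume y,
      ← integral_mul_const]
    congr 1
    funext x
    ring

lemma norm_integral_le_pow_mul_norm_integral_window (hb0 : 0 < b) (hb1 : b < 1)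
    (f : 𝓢(Euc n, ℂ)) {lam : ℝ} (hlam : 1 ≤ lam) :
    ‖∫ z, f z‖ ≤ lam ^ n * ‖∫ z, window b lam f z‖ := by
  have hlam0 : 0 < lam := by linarith
  have hr0 : 0 < lam ^ b := Real.rpow_pos_of_pos hlam0 b
  have hc : 1 ≤ lam ^ ((n : ℝ) * b / 2) := Real.one_le_rpow hlam (by positivity)
  rw [coe_window b hlam]
  simp only [dilate]
  rw [integral_const_mul, Measure.integral_comp_smul, finrank_euclideanSpace_fin, norm_mul,
    norm_smul, Complex.norm_real, Real.norm_of_nonneg (by positivity),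
    Real.norm_of_nonneg (by positivity), abs_of_pos (by positivity)]
  have h1 : 1 ≤ lam ^ n * ((lam ^ b) ^ n)⁻¹ := by
    rw [← div_eq_mul_inv, one_le_div (by positivity)]
    exact rpow_pow_le_pow hlam hb1 n
  calc ‖∫ z, f z‖ ≤ (lam ^ n * ((lam ^ b) ^ n)⁻¹) * lam ^ ((n : ℝ) * b / 2) * ‖∫ z, f z‖ :=
        le_mul_of_one_le_left (norm_nonneg _) (one_le_mul_of_one_le_of_one_le h1 hc)
    _ = _ := by ring

lemma integral_mul_conj_ne_zero {φ : 𝓢(Euc n, ℂ)} (hφ : φ ≠ 0) :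
    ∫ z, mulSchwartz φ (conjSchwartz φ) z ≠ 0 := by
  obtain ⟨x, hx⟩ : ∃ x, φ x ≠ 0 := by
    by_contra! h
    exact hφ (by ext x; simpa using h x)
  have hfun : ∀ z, mulSchwartz φ (conjSchwartz φ) z = ((‖φ z‖ ^ 2 : ℝ) : ℂ) := by
    intro z
    rw [mulSchwartz_apply, conjSchwartz_apply, Complex.mul_conj, Complex.normSq_eq_norm_sq]
  have hint : Integrable fun z => ‖φ z‖ ^ 2 := by
    have := (mulSchwartz φ (conjSchwartz φ)).integrable (μ := volume)
    refine this.norm.congr (Filter.Eventually.of_forall fun z => ?_)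
    simp only
    rw [hfun, Complex.norm_real, Real.norm_of_nonneg (by positivity)]
  simp only [hfun]
  rw [integral_complex_ofReal]
  have := integral_pos_of_integrable_nonneg_nonzero (μ := volume) (x := x)
    (f := fun z => ‖φ z‖ ^ 2) (φ.continuous.norm.pow 2) hint (fun z => by positivity) (by simpa)
  exact_mod_cast this.ne'

lemma mulSchwartz_window_window {lam : ℝ} (hlam : 1 ≤ lam) (φ ψ : 𝓢(Euc n, ℂ)) (x : Euc n) :
    mulSchwartz ((window b lam φ).compSubConstCLM ℂ x) ((window b lam ψ).compSubConstCLM ℂ x) =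
      ((lam ^ ((n : ℝ) * b / 2) : ℝ) : ℂ) •
        (window b lam (mulSchwartz φ ψ)).compSubConstCLM ℂ x := by
  ext y
  simp only [mulSchwartz_apply, SchwartzMap.compSubConstCLM_apply, smul_apply, smul_eq_mul,
    coe_window b hlam, dilate]
  ring

/-- Rapid decay of the wave packet transform with a single window excludes points from the wave
front set. -/
lemma notInWFdist_of_wavePacket_decay (hb0 : 0 < b) (hb1 : b < 1)
    {u : 𝓢(Euc n, ℂ) →L[ℂ] ℂ} {ξ₀ : Euc n} {φ : 𝓢(Euc n, ℂ)} (hφ : φ ≠ 0)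
    {K Γ : Set (Euc n)} (hK : K ∈ nhds x₀) (hΓ : IsConicNbhd Γ ξ₀)
    (h : ∀ N : ℕ, ∀ a : ℝ, 1 ≤ a → ∃ C : ℝ, 0 < C ∧
      ∀ lam : ℝ, 1 ≤ lam → ∀ x ∈ K, ∀ ξ ∈ Γ, a⁻¹ ≤ ‖ξ‖ → ‖ξ‖ ≤ a →
        ‖WPTdist u (dilate b lam ⇑φ) x (lam • ξ)‖ ≤ C * lam ^ (-(N : ℝ))) :
    NotInWFdist u x₀ ξ₀ := by
  obtain ⟨R, hR, hRK⟩ := Metric.nhds_basis_closedBall.mem_iff.1 hK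
  let χ : ContDiffBump x₀ := ⟨R / 4, R / 2, by positivity, by linarith⟩
  obtain ⟨X, hX⟩ := exists_schwartz_eq_ofReal χ.contDiff χ.hasCompactSupport
  have hX0 : ∀ y, R / 2 ≤ ‖y - x₀‖ → X y = 0 := by
    intro y hy
    rw [hX, χ.zero_of_le_dist (by rwa [dist_eq_norm]), Complex.ofReal_zero]
  obtain ⟨Γ₁, hΓ₁, hΓ₁₀⟩ := hΓ.exists_wellInside
  obtain ⟨Γ₂, hΓ₂, hΓ₂₁⟩ := hΓ₁.exists_wellInside
  refine ⟨χ, χ.contDiff, χ.hasCompactSupport, ?_, Γ₂, hΓ₂, fun N => ?_⟩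
  · rw [χ.one_of_mem_closedBall (Metric.mem_closedBall_self (by simp only [χ]; positivity))]
    exact one_ne_zero
  let L : {p : ℝ × Euc n // 1 ≤ p.1 ∧ p.2 ∈ Metric.closedBall x₀ R} → ℝ := fun i => i.1.1
  have hL : ∀ i, 1 ≤ L i := fun i => i.2.1
  have hxR : ∀ i : {p : ℝ × Euc n // 1 ≤ p.1 ∧ p.2 ∈ Metric.closedBall x₀ R},
      ‖i.1.2‖ ≤ R + ‖x₀‖ := by
    intro i
    have h1 := norm_add_le (i.1.2 - x₀) x₀
    rw [sub_add_cancel] at h1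
    linarith [mem_closedBall_iff_norm.1 i.2.2]
  have hp := polyGrowth_window hb0 hb1 hL u (conjSchwartz φ) hxR
  have hr : RapidOn L (fun i ζ => u (modulate ζ
      ((window b (L i) (conjSchwartz φ)).compSubConstCLM ℂ i.1.2))) Γ := by
    intro N a ha
    obtain ⟨C, hC, h⟩ := h N a ha
    refine ⟨C, hC.le, fun i ξ hξ h1 h2 => ?_⟩
    have h3 := h (L i) (hL i) i.1.2 (hRK i.2.2) ξ hξ h1 h2
    have hL0 : 0 < L i := by linarith [hL i]
    rw [WPTdist_dilate u b (hL i), conjSchwartz_window b (hL i), Real.rpow_neg hL0.le,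
      Real.rpow_natCast, ← div_eq_mul_inv, le_div_iff₀ (by positivity)] at h3
    exact h3
  have hw := scaledDecay_window hL hb0 φ fun i => i.1.2
  have hrX := RapidOn.mulSchwartz hL hb1 (hp.mulSchwartz hL hb1 hw)
    (hr.mulSchwartz hL hb1 hp hΓ₁₀ hw) hΓ₂₁ (scaledDecay_const hL hb0 (𝓕 X : 𝓢(Euc n, ℂ)))
  set f := mulSchwartz φ (conjSchwartz φ) with hf
  obtain ⟨C₁, hC₁, hnear⟩ := hrX (N + n) 1 le_rfl
  obtain ⟨C₂, hC₂, hfar⟩ := exists_mul_window_far_le hb0 hb1 (half_pos hR) hX0 f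
    (continuous_normSeminormComp u) (N + n) (n + 1) (le_refl (1 : ℝ))
  set A := C₁ * (1 + (R + ‖x₀‖)) ^ (n + 1) + C₂ with hA
  have hA0 : 0 ≤ A := by positivity
  have hbound : ∀ lam : ℝ, 1 ≤ lam → ∀ ξ ∈ Γ₂, ‖ξ‖ = 1 → ∀ x,
      ‖u (modulate (lam • ξ) (mulSchwartz X ((window b lam f).compSubConstCLM ℂ x)))‖ *
        lam ^ (N + n) * (1 + ‖x‖) ^ (n + 1) ≤ A := by
    intro lam hlam ξ hξ hξ1 x
    have hlam0 : 0 < lam := by linarith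
    rcases le_total ‖x - x₀‖ R with hx | hx
    · let i : {p : ℝ × Euc n // 1 ≤ p.1 ∧ p.2 ∈ Metric.closedBall x₀ R} :=
        ⟨(lam, x), hlam, mem_closedBall_iff_norm.2 hx⟩
      have h1 := hnear i ξ hξ (by rw [hξ1, inv_one]) hξ1.le
      change ‖u (modulate (lam • ξ) (mulSchwartz X (mulSchwartz
        ((window b lam φ).compSubConstCLM ℂ x)
        ((window b lam (conjSchwartz φ)).compSubConstCLM ℂ x))))‖ * lam ^ (N + n) ≤ C₁ at h1
      rw [mulSchwartz_window_window hlam, map_smul, map_smul, map_smul, norm_smul,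
        Complex.norm_real, Real.norm_of_nonneg (by positivity)] at h1
      have hc : 1 ≤ lam ^ ((n : ℝ) * b / 2) := Real.one_le_rpow hlam (by positivity)
      have h2 : ‖u (modulate (lam • ξ) (mulSchwartz X ((window b lam f).compSubConstCLM ℂ x)))‖ *
          lam ^ (N + n) ≤ C₁ :=
        (mul_le_mul_of_nonneg_right (le_mul_of_one_le_left (norm_nonneg _) hc)
          (by positivity)).trans h1
      refine (mul_le_mul h2 (pow_le_pow_left₀ (by positivity) (add_le_add_right (hxR i) 1) _)
        (by positivity) hC₁).trans ?_
      exact le_add_of_nonneg_right hC₂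
    · exact (hfar lam hlam x (by linarith) ξ hξ1.le).trans
        (le_add_of_nonneg_left (by positivity))
  set J := ∫ η : Euc n, ((1 + ‖η‖) ^ (n + 1))⁻¹ with hJ
  have hJ0 : 0 ≤ J := integral_nonneg fun η => by positivity
  have hc0 : 0 < ‖∫ z, f z‖ := norm_pos_iff.2 (integral_mul_conj_ne_zero hφ)
  obtain ⟨C₀, M, hC₀, hpoly⟩ := polyGrowth_modulate (ι := Unit) (L := fun _ => 1)
    (fun _ => le_rfl) u X
  set D := max (C₀ * 2 ^ M * 2 ^ N) (A * J / ‖∫ z, f z‖ * 2 ^ N) with hD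
  refine ⟨D + 1, by positivity, fun ζ hζ => ?_⟩
  rw [pairing_mul_exp u X fun y => (hX y).symm]
  refine norm_le_mul_rpow_neg (by positivity) ?_
  rcases le_total ‖ζ‖ 1 with hζ1 | hζ1
  · refine le_trans ?_ (le_max_left _ _)
    have := hpoly () ζ
    rw [one_mul] at this
    have h2 : 1 + ‖ζ‖ ≤ 2 := by linarith
    calc _ ≤ C₀ * (1 + ‖ζ‖) ^ M * (1 + ‖ζ‖) ^ N := by gcongr
      _ ≤ _ := by gcongr
  · refine le_trans ?_ (le_max_right _ _)
    set lam := ‖ζ‖ with hlam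
    have hlam0 : 0 < lam := by linarith
    have hξ1 : ‖lam⁻¹ • ζ‖ = 1 := by
      rw [norm_smul, norm_inv, norm_norm, inv_mul_cancel₀ hlam0.ne']
    have hb := hbound lam hζ1 _ (hΓ₂.2 ζ hζ lam⁻¹ (by positivity)) hξ1
    rw [smul_inv_smul₀ hlam0.ne'] at hb
    have hI := norm_integral_le_of_decay (A := A / lam ^ (N + n))
      (f := fun x => u (modulate ζ (mulSchwartz X ((window b lam f).compSubConstCLM ℂ x)))) ?_
    · rw [← integral_mul_apply_modulate hb0 hb1 (half_pos hR) hX0 u f hζ1, norm_mul] at hI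
      have hW := norm_integral_le_pow_mul_norm_integral_window hb0 hb1 f hζ1
      have key : ‖u (modulate ζ X)‖ * lam ^ N ≤ A * J / ‖∫ z, f z‖ := by
        rw [le_div_iff₀ hc0]
        calc ‖u (modulate ζ X)‖ * lam ^ N * ‖∫ z, f z‖
            ≤ ‖u (modulate ζ X)‖ * lam ^ N * (lam ^ n * ‖∫ z, window b lam f z‖) := by gcongr
          _ = (‖∫ z, window b lam f z‖ * ‖u (modulate ζ X)‖) * lam ^ (N + n) := by
              rw [pow_add]; ring
          _ ≤ (A / lam ^ (N + n) * J) * lam ^ (N + n) := by gcongr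
          _ = A * J := by field_simp
      calc ‖u (modulate ζ X)‖ * (1 + lam) ^ N ≤ ‖u (modulate ζ X)‖ * (2 * lam) ^ N := by
            gcongr
            linarith
        _ = (‖u (modulate ζ X)‖ * lam ^ N) * 2 ^ N := by rw [mul_pow]; ring
        _ ≤ _ := by gcongr
    · intro x
      rw [le_div_iff₀ (by positivity), mul_right_comm]
      exact hb x

end Converse

/-- Characterisation of the wave front set of a tempered distribution
by the wave packet transform with dilated windows: (i) ↔ (ii) and (ii) ↔ (iii). -/
theorem wavefront_wavePacket_characterization (hn : 1 ≤ n) (b : ℝ)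
    (hb0 : 0 < b) (hb1 : b < 1)
    (u : SchwartzMap (Euc n) ℂ →L[ℂ] ℂ) (x₀ ξ₀ : Euc n) (hξ₀ : ξ₀ ≠ 0) :
    (NotInWFdist u x₀ ξ₀ ↔
      (∃ φ : SchwartzMap (Euc n) ℂ, φ ≠ 0 ∧
        ∃ K Γ : Set (Euc n), K ∈ nhds x₀ ∧ IsConicNbhd Γ ξ₀ ∧
          ∀ N : ℕ, ∀ a : ℝ, 1 ≤ a →
            ∃ C : ℝ, 0 < C ∧
              ∀ lam : ℝ, 1 ≤ lam → ∀ x ∈ K, ∀ ξ ∈ Γ, a⁻¹ ≤ ‖ξ‖ → ‖ξ‖ ≤ a →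
                ‖WPTdist u (dilate b lam ⇑φ) x (lam • ξ)‖ ≤ C * lam ^ (-(N : ℝ)))) ∧
    ((∃ φ : SchwartzMap (Euc n) ℂ, φ ≠ 0 ∧
        ∃ K Γ : Set (Euc n), K ∈ nhds x₀ ∧ IsConicNbhd Γ ξ₀ ∧
          ∀ N : ℕ, ∀ a : ℝ, 1 ≤ a →
            ∃ C : ℝ, 0 < C ∧
              ∀ lam : ℝ, 1 ≤ lam → ∀ x ∈ K, ∀ ξ ∈ Γ, a⁻¹ ≤ ‖ξ‖ → ‖ξ‖ ≤ a →
                ‖WPTdist u (dilate b lam ⇑φ) x (lam • ξ)‖ ≤ C * lam ^ (-(N : ℝ))) ↔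
      (∃ K Γ : Set (Euc n), K ∈ nhds x₀ ∧ IsConicNbhd Γ ξ₀ ∧
        ∀ φ : SchwartzMap (Euc n) ℂ, φ ≠ 0 →
          ∀ N : ℕ, ∀ a : ℝ, 1 ≤ a →
            ∃ C : ℝ, 0 < C ∧
              ∀ lam : ℝ, 1 ≤ lam → ∀ x ∈ K, ∀ ξ ∈ Γ, a⁻¹ ≤ ‖ξ‖ → ‖ξ‖ ≤ a →
                ‖WPTdist u (dilate b lam ⇑φ) x (lam • ξ)‖ ≤ C * lam ^ (-(N : ℝ)))) := by
  have direct := fun h : NotInWFdist u x₀ ξ₀ => h.exists_wavePacket_decay hb0 hb1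
  obtain ⟨ψ, hψ⟩ : ∃ ψ : SchwartzMap (Euc n) ℂ, ψ ≠ 0 := by
    let χ : ContDiffBump x₀ := ⟨1, 2, one_pos, one_lt_two⟩
    obtain ⟨X, hX⟩ := exists_schwartz_eq_ofReal χ.contDiff χ.hasCompactSupport
    refine ⟨X, fun h => ?_⟩
    have h1 := hX x₀
    rw [χ.one_of_mem_closedBall (Metric.mem_closedBall_self zero_le_one), h] at h1
    simp at h1
  refine ⟨⟨fun h => ?_, ?_⟩, ⟨?_, ?_⟩⟩
  · obtain ⟨K, Γ, hK, hΓ, hdecay⟩ := direct h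
    exact ⟨ψ, hψ, K, Γ, hK, hΓ, hdecay ψ⟩
  · rintro ⟨φ, hφ, K, Γ, hK, hΓ, hdecay⟩
    exact notInWFdist_of_wavePacket_decay hb0 hb1 hφ hK hΓ hdecay
  · rintro ⟨φ, hφ, K, Γ, hK, hΓ, hdecay⟩
    obtain ⟨K', Γ', hK', hΓ', hdecay'⟩ :=
      direct (notInWFdist_of_wavePacket_decay hb0 hb1 hφ hK hΓ hdecay)
    exact ⟨K', Γ', hK', hΓ', fun φ _ => hdecay' φ⟩
  · rintro ⟨K, Γ, hK, hΓ, hdecay⟩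
    exact ⟨ψ, hψ, K, Γ, hK, hΓ, hdecay ψ hψ⟩

end
end

section
/- Let n ≥ 1 and let u₀, φ₀ ∈ 𝒮(ℝⁿ). Set φ^{(t)} = U₀(t)φ₀ and u(t,·) = U₀(t)u₀, where U₀(t) is the free Schrödinger evolution. Then for all t ∈ ℝ and all x, ξ ∈ ℝⁿ: W_{φ^{(t)}}[u(t,·)](x, ξ) = e^{−i t |ξ|²/2} · W_{φ₀} u₀(x − tξ, ξ). -/
open MeasureTheory Complex
open scoped InnerProductSpace BigOperators

noncomputable section

variable {n : ℕ}

open scoped FourierTransform SchwartzMap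

lemma hasTemperateGrowth_cexp_I_mul :
    (fun s : ℝ => Complex.exp (Complex.I * s)).HasTemperateGrowth := by
  refine ⟨(contDiff_const.mul Complex.ofRealCLM.contDiff).cexp, fun k => ⟨0, 1, fun s => ?_⟩⟩
  have h : ∀ k : ℕ, iteratedDeriv k (fun s : ℝ => Complex.exp (Complex.I * s)) =
      fun s : ℝ => Complex.I ^ k * Complex.exp (Complex.I * s) := by
    intro k
    induction k with
    | zero => simp
    | succ k ih =>
      rw [iteratedDeriv_succ, ih]
      ext s
      have h₁ : HasDerivAt (fun s : ℝ => Complex.I * (s : ℂ)) (Complex.I * 1) s :=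
        (Complex.ofRealCLM.hasDerivAt (x := s)).const_mul Complex.I
      rw [(h₁.cexp.const_mul _).deriv]
      ring
  rw [norm_iteratedFDeriv_eq_norm_iteratedDeriv, h]
  simp [mul_comm Complex.I, Complex.norm_exp_ofReal_mul_I]

/-- The multiplier of the free Schrödinger evolution for the Fourier transform with kernel
`e^{-2πi y·η}`. -/
def schrodingerSymbol (t : ℝ) (η : Euc n) : ℂ :=
  Complex.exp (Complex.I * ((-(2 * Real.pi ^ 2 * t) * ‖η‖ ^ 2 : ℝ) : ℂ))

lemma hasTemperateGrowth_schrodingerSymbol (t : ℝ) :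
    (schrodingerSymbol t : Euc n → ℂ).HasTemperateGrowth :=
  hasTemperateGrowth_cexp_I_mul.comp (f := fun η : Euc n => -(2 * Real.pi ^ 2 * t) * ‖η‖ ^ 2)
    (by fun_prop)

lemma FT_smul_two_pi (f : Euc n → ℂ) (η : Euc n) : FT f ((2 * Real.pi) • η) = 𝓕 f η := by
  rw [FT, Real.fourier_eq']
  refine integral_congr_ae (.of_forall fun y => ?_)
  simp only [inner_smul_right, smul_eq_mul]
  congr 2
  push_cast
  ring

lemma U0_eq_fourierMultiplier (t : ℝ) (f : 𝓢(Euc n, ℂ)) :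
    U0 t ⇑f = ⇑(SchwartzMap.fourierMultiplierCLM ℂ (schrodingerSymbol t) f) := by
  ext x
  have hpi : (0 : ℝ) < (2 * Real.pi) ^ n := by positivity
  rw [SchwartzMap.fourierMultiplierCLM_apply, SchwartzMap.fourierInv_coe, Real.fourierInv_eq']
  have h := Measure.integral_comp_smul (volume : Measure (Euc n))
    (fun ξ => Complex.exp (Complex.I * ((⟪x, ξ⟫_ℝ - t * ‖ξ‖ ^ 2 / 2 : ℝ) : ℂ)) * FT f ξ)
    (2 * Real.pi)
  rw [finrank_euclideanSpace_fin, abs_of_pos (inv_pos.2 hpi)] at h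
  rw [U0, ← h]
  refine integral_congr_ae (.of_forall fun η => ?_)
  simp only [FT_smul_two_pi, smul_eq_mul, schrodingerSymbol,
    SchwartzMap.smulLeftCLM_apply_apply (hasTemperateGrowth_schrodingerSymbol t),
    SchwartzMap.fourier_coe, ← mul_assoc, ← Complex.exp_add]
  congr 2
  rw [norm_smul, inner_smul_right, Real.norm_of_nonneg (by positivity), real_inner_comm]
  push_cast
  ring

lemma fourier_modulation_translation (φ : Euc n → ℂ) (x ζ η : Euc n) :
    𝓕 (fun y => Complex.exp (((2 * Real.pi * ⟪y, ζ⟫_ℝ : ℝ) : ℂ) * Complex.I) * φ (y - x)) η =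
      Complex.exp (((-2 * Real.pi * ⟪x, η - ζ⟫_ℝ : ℝ) : ℂ) * Complex.I) * 𝓕 φ (η - ζ) := by
  rw [Real.fourier_eq', Real.fourier_eq', ← integral_const_mul,
    ← integral_add_right_eq_self (μ := (volume : Measure (Euc n))) _ x]
  refine integral_congr_ae (.of_forall fun y => ?_)
  simp only [smul_eq_mul, ← mul_assoc, ← Complex.exp_add]
  rw [add_sub_cancel_right]
  congr 2
  simp only [inner_add_left, inner_sub_right]
  push_cast
  ring

/-- The wave packet transform on the Fourier side. -/
lemma WPT_eq_integral_fourier (φ u : 𝓢(Euc n, ℂ)) (x ζ : Euc n) :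
    WPT φ u x ((2 * Real.pi) • ζ) =
      ∫ η, Complex.exp (((2 * Real.pi * ⟪x, η - ζ⟫_ℝ : ℝ) : ℂ) * Complex.I) *
        (starRingEnd ℂ) (𝓕 φ (η - ζ)) * 𝓕 u η := by
  set h : Euc n → ℂ :=
    fun y => Complex.exp (((2 * Real.pi * ⟪y, ζ⟫_ℝ : ℝ) : ℂ) * Complex.I) * φ (y - x) with hh
  have hint : Integrable h := by
    refine (φ.integrable.comp_sub_right x).bdd_mul (c := 1) ?_ (.of_forall fun y => ?_)
    · exact Continuous.aestronglyMeasurable (by fun_prop)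
    · rw [Complex.norm_exp_ofReal_mul_I]
  have key : ∫ η, innerSL ℂ (𝓕 h η) (𝓕 u η) = ∫ y, innerSL ℂ (h y) (u y) := by
    have hinv : ⇑u = 𝓕⁻ (⇑(𝓕 u : 𝓢(Euc n, ℂ))) := by
      rw [← SchwartzMap.fourierInv_coe, FourierTransform.fourierInv_fourier_eq]
    have hflip : -(innerₗ (Euc n)).flip = -innerₗ (Euc n) := by rw [flip_innerₗ]
    have hswap := VectorFourier.integral_sesq_fourierIntegral_eq_neg_flip (μ := volume)
      (ν := volume) (innerSL ℂ) (L := innerₗ (Euc n)) Real.continuous_fourierChar continuous_inner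
      hint (𝓕 u).integrable
    rw [hflip] at hswap
    rw [hinv]
    exact hswap
  calc WPT φ u x ((2 * Real.pi) • ζ) = ∫ y, innerSL ℂ (h y) (u y) := by
        refine integral_congr_ae (.of_forall fun y => ?_)
        simp only [hh, innerSL_apply_apply, RCLike.inner_apply, map_mul, ← Complex.exp_conj,
          Complex.conj_I, Complex.conj_ofReal, inner_smul_right]
        ring_nf
    _ = _ := key.symm
    _ = _ := by
        refine integral_congr_ae (.of_forall fun η => ?_)
        simp only [hh, fourier_modulation_translation, innerSL_apply_apply, RCLike.inner_apply,
          map_mul, ← Complex.exp_conj, Complex.conj_I, Complex.conj_ofReal,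
          SchwartzMap.fourier_coe]
        push_cast
        ring_nf

/-- Representation of the free Schrödinger evolution via the wave
packet transform: `W_{φ^{(t)}}[u(t,·)](x, ξ) = e^{-i t |ξ|²/2} W_{φ₀} u₀ (x - tξ, ξ)`. -/
theorem wavePacket_free_evolution (hn : 1 ≤ n)
    (u₀ φ₀ : SchwartzMap (Euc n) ℂ) (t : ℝ) (x ξ : Euc n) :
    WPT (U0 t ⇑φ₀) (U0 t ⇑u₀) x ξ =
      Complex.exp (-Complex.I * ((t * ‖ξ‖ ^ 2 / 2 : ℝ) : ℂ)) *
        WPT ⇑φ₀ ⇑u₀ (x - t • ξ) ξ := by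
  obtain ⟨ζ, rfl⟩ : ∃ ζ : Euc n, ξ = (2 * Real.pi) • ζ :=
    ⟨(2 * Real.pi)⁻¹ • ξ, by rw [smul_inv_smul₀ (by positivity)]⟩
  rw [U0_eq_fourierMultiplier, U0_eq_fourierMultiplier, WPT_eq_integral_fourier,
    WPT_eq_integral_fourier, ← integral_const_mul]
  refine integral_congr_ae (.of_forall fun η => ?_)
  simp only [SchwartzMap.fourierMultiplierCLM_apply, FourierTransform.fourier_fourierInv_eq,
    SchwartzMap.smulLeftCLM_apply_apply (hasTemperateGrowth_schrodingerSymbol t), smul_eq_mul,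
    map_mul, schrodingerSymbol, ← Complex.exp_conj, Complex.conj_I, Complex.conj_ofReal]
  have hexp : Complex.exp (((2 * Real.pi * ⟪x, η - ζ⟫_ℝ : ℝ) : ℂ) * Complex.I) *
      Complex.exp (-Complex.I * ((-(2 * Real.pi ^ 2 * t) * ‖η - ζ‖ ^ 2 : ℝ) : ℂ)) *
      Complex.exp (Complex.I * ((-(2 * Real.pi ^ 2 * t) * ‖η‖ ^ 2 : ℝ) : ℂ)) =
      Complex.exp (-Complex.I * ((t * ‖(2 * Real.pi) • ζ‖ ^ 2 / 2 : ℝ) : ℂ)) *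
      Complex.exp (((2 * Real.pi * ⟪x - t • (2 * Real.pi) • ζ, η - ζ⟫_ℝ : ℝ) : ℂ) *
        Complex.I) := by
    simp only [← Complex.exp_add]
    congr 1
    simp only [norm_sub_sq_real, norm_smul, inner_sub_left, inner_sub_right, real_inner_smul_left,
      Real.norm_of_nonneg Real.two_pi_pos.le, real_inner_self_eq_norm_sq, real_inner_comm ζ η]
    push_cast
    ring
  linear_combination
    (starRingEnd ℂ) (𝓕 φ₀ (η - ζ)) * 𝓕 u₀ η * hexp

end
end

section
/- Let n ≥ 1, let V : ℝ × ℝⁿ → ℝ be C^∞ and sub-quadratic with exponent ρ ∈ [0,2). Let u : ℝ × ℝⁿ → ℂ be smooth, with t ↦ u(t,·) a C¹ map from ℝ into the Schwartz space 𝒮(ℝⁿ), satisfying i∂_t u + (1/2)Δu − V(t,x)u = 0 pointwise. Let φ₀ ∈ 𝒮(ℝⁿ), φ^{(t)} = U₀(t)φ₀, and define F(t,x,ξ) = ∫ conj(φ^{(t)}(y−x)) u(t,y) e^{−i y·ξ} dy. Then for all (t,x,ξ) ∈ ℝ × ℝⁿ × ℝⁿ: i∂_t F + i ξ·∇_x F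 − i ∇_x V(t,x)·∇_ξ F − ( (1/2)|ξ|² + V(t,x) − x·∇_x V(t,x) ) F = ∫ conj(φ^{(t)}(y−x)) [ V(t,y) − V(t,x) − ∇_x V(t,x)·(y−x) ] u(t,y) e^{−i y·ξ} dy. -/
open MeasureTheory Complex
open scoped InnerProductSpace BigOperators

noncomputable section

variable {n : ℕ}

open scoped SchwartzMap FourierTransform LineDeriv

lemma ofReal_norm_sq_eq_sum (η : Euc n) :
    ((‖η‖ ^ 2 : ℝ) : ℂ) = ∑ j : Fin n, ((η j : ℝ) : ℂ) ^ 2 := by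
  rw [EuclideanSpace.real_norm_sq_eq]
  push_cast
  rfl

/-- Multiplication of a Schwartz function by `i ⟨v, ·⟩`. -/
def mulInner (v : Euc n) : 𝓢(Euc n, ℂ) →L[ℂ] 𝓢(Euc n, ℂ) :=
  SchwartzMap.smulLeftCLM ℂ fun η : Euc n => I * ((⟪v, η⟫_ℝ : ℝ) : ℂ)

lemma mulInner_apply (v : Euc n) (h : 𝓢(Euc n, ℂ)) (η : Euc n) :
    mulInner v h η = I * ((⟪v, η⟫_ℝ : ℝ) : ℂ) * h η := by
  rw [mulInner, SchwartzMap.smulLeftCLM_apply_apply (by fun_prop), smul_eq_mul]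

/-- The symbol `-i|η|²/2` of the free evolution, acting on Schwartz functions. -/
def freeGenerator (h : 𝓢(Euc n, ℂ)) : 𝓢(Euc n, ℂ) :=
  (I / 2) • ∑ j : Fin n,
    mulInner (EuclideanSpace.single j 1) (mulInner (EuclideanSpace.single j 1) h)

lemma freeGenerator_apply (h : 𝓢(Euc n, ℂ)) (η : Euc n) :
    freeGenerator h η = -I * ((‖η‖ ^ 2 / 2 : ℝ) : ℂ) * h η := by
  have hj : ∀ j : Fin n, mulInner (EuclideanSpace.single j 1)
      (mulInner (EuclideanSpace.single j 1) h) η = -((η j : ℝ) : ℂ) ^ 2 * h η := by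
    intro j
    simp only [mulInner_apply, EuclideanSpace.inner_single_left, map_one, one_mul]
    linear_combination ((η j : ℝ) : ℂ) ^ 2 * h η * I_sq
  simp only [freeGenerator, smul_apply, sum_apply, hj, smul_eq_mul]
  rw [← Finset.sum_mul, Finset.sum_neg_distrib, ← ofReal_norm_sq_eq_sum]
  push_cast
  ring

/-- The superposition of free plane waves with amplitude `h`. -/
def freeWave (h : 𝓢(Euc n, ℂ)) (t : ℝ) (x : Euc n) : ℂ :=
  ∫ η, Complex.exp (I * ((⟪x, η⟫_ℝ - t * ‖η‖ ^ 2 / 2 : ℝ) : ℂ)) * h η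

lemma norm_exp_I_mul_real_mul (r : ℝ) (z : ℂ) : ‖Complex.exp (I * (r : ℂ)) * z‖ = ‖z‖ := by
  rw [norm_mul, mul_comm I, norm_exp_ofReal_mul_I, one_mul]

lemma norm_exp_neg_I_mul_real (r : ℝ) : ‖Complex.exp (-I * (r : ℂ))‖ = 1 := by
  simpa using norm_exp_I_mul_real_mul (-r) 1

lemma integrable_freeWave (h : 𝓢(Euc n, ℂ)) (t : ℝ) (x : Euc n) :
    Integrable fun η : Euc n =>
      Complex.exp (I * ((⟪x, η⟫_ℝ - t * ‖η‖ ^ 2 / 2 : ℝ) : ℂ)) * h η := by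
  refine h.integrable.norm.mono' ?_ (.of_forall fun η => (norm_exp_I_mul_real_mul _ _).le)
  have := h.continuous
  exact Continuous.aestronglyMeasurable (by fun_prop)

lemma norm_freeWave_le (h : 𝓢(Euc n, ℂ)) (t : ℝ) (x : Euc n) :
    ‖freeWave h t x‖ ≤ ∫ η, ‖h η‖ := by
  refine (norm_integral_le_integral_norm _).trans_eq ?_
  simp only [norm_exp_I_mul_real_mul]

lemma freeWave_smul (c : ℂ) (h : 𝓢(Euc n, ℂ)) (t : ℝ) (x : Euc n) :
    freeWave (c • h) t x = c * freeWave h t x := by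
  rw [freeWave, freeWave, ← integral_const_mul]
  congr 1 with η
  rw [smul_apply, smul_eq_mul]
  ring

lemma freeWave_sum {ι : Type*} (s : Finset ι) (h : ι → 𝓢(Euc n, ℂ)) (t : ℝ) (x : Euc n) :
    freeWave (∑ i ∈ s, h i) t x = ∑ i ∈ s, freeWave (h i) t x := by
  simp only [freeWave, sum_apply, Finset.mul_sum]
  exact integral_finsetSum s fun i _ => integrable_freeWave (h i) t x

/-- `freeWave` has a bounded space derivative, which multiplies the amplitude by `i ⟨v, ·⟩`. -/
lemma exists_hasFDerivAt_freeWave (h : 𝓢(Euc n, ℂ)) (t : ℝ) (x : Euc n) :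
    ∃ L : Euc n →L[ℝ] ℂ, HasFDerivAt (freeWave h t) L x ∧
      (∀ v, L v = freeWave (mulInner v h) t x) ∧ ‖L‖ ≤ ∫ η, ‖η‖ * ‖h η‖ := by
  let E : Euc n → Euc n → ℂ := fun x η =>
    Complex.exp (I * ((⟪x, η⟫_ℝ - t * ‖η‖ ^ 2 / 2 : ℝ) : ℂ)) * h η
  let E' : Euc n → Euc n → Euc n →L[ℝ] ℂ := fun x η =>
    (E x η * I) • (ofRealCLM ∘L innerSL ℝ η)
  have hbi : Integrable fun η : Euc n => ‖η‖ * ‖h η‖ := by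
    simpa using h.integrable_pow_mul volume 1
  have hE' : ∀ x η, ‖E' x η‖ ≤ ‖η‖ * ‖h η‖ := by
    intro x η
    refine ContinuousLinearMap.opNorm_le_bound _ (by positivity) fun v => ?_
    simp only [E', E, smul_apply, ContinuousLinearMap.comp_apply,
      innerSL_apply_apply, ofRealCLM_apply, smul_eq_mul, norm_mul, norm_I, mul_one]
    rw [← norm_mul, norm_exp_I_mul_real_mul, norm_real]
    nlinarith [norm_inner_le_norm (𝕜 := ℝ) η v, norm_nonneg (h η)]
  have hmeas : AEStronglyMeasurable (E' x) volume := by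
    have := h.continuous
    refine Continuous.aestronglyMeasurable ?_
    have h1 : Continuous fun η : Euc n => ofRealCLM ∘L innerSL ℝ η :=
      (ContinuousLinearMap.compL ℝ (Euc n) ℝ ℂ ofRealCLM).continuous.comp (innerSL ℝ).continuous
    have h2 : Continuous fun η : Euc n => E x η * I := by fun_prop
    exact h2.smul h1
  have hderiv := hasFDerivAt_integral_of_dominated_of_fderiv_le (𝕜 := ℝ) (μ := volume)
    (F := E) (F' := E') (x₀ := x) (s := Set.univ) (bound := fun η => ‖η‖ * ‖h η‖)
    Filter.univ_mem (.of_forall fun z => (integrable_freeWave h t z).aestronglyMeasurable)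
    (integrable_freeWave h t x) hmeas (.of_forall fun η z _ => hE' z η) hbi ?_
  · refine ⟨_, hderiv, fun v => ?_, ?_⟩
    · rw [ContinuousLinearMap.integral_apply (hbi.mono' hmeas (.of_forall (hE' x)))]
      refine integral_congr_ae (.of_forall fun η => ?_)
      simp only [E', E, smul_apply, ContinuousLinearMap.comp_apply,
        innerSL_apply_apply, ofRealCLM_apply, smul_eq_mul, mulInner_apply, real_inner_comm]
      ring
    · exact norm_integral_le_of_norm_le hbi (.of_forall (hE' x))
  · refine .of_forall fun η z _ => ?_
    have h1 : HasFDerivAt (fun z : Euc n => ⟪z, η⟫_ℝ - t * ‖η‖ ^ 2 / 2) (innerSL ℝ η) z := by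
      simpa [real_inner_comm] using ((innerSL ℝ η).hasFDerivAt (x := z)).sub_const
        (t * ‖η‖ ^ 2 / 2)
    have h2 := ((ofRealCLM.hasFDerivAt.comp z h1).const_mul I).cexp.mul_const (h η)
    refine h2.congr_fderiv ?_
    ext v
    simp [E', E]
    ring

lemma differentiable_freeWave (h : 𝓢(Euc n, ℂ)) (t : ℝ) : Differentiable ℝ (freeWave h t) :=
  fun x => (exists_hasFDerivAt_freeWave h t x).choose_spec.1.differentiableAt

lemma fderiv_freeWave (h : 𝓢(Euc n, ℂ)) (t : ℝ) (x v : Euc n) :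
    fderiv ℝ (freeWave h t) x v = freeWave (mulInner v h) t x := by
  obtain ⟨L, hL, hv, -⟩ := exists_hasFDerivAt_freeWave h t x
  rw [hL.fderiv, hv]

lemma norm_fderiv_freeWave_le (h : 𝓢(Euc n, ℂ)) (t : ℝ) (x : Euc n) :
    ‖fderiv ℝ (freeWave h t) x‖ ≤ ∫ η, ‖η‖ * ‖h η‖ := by
  obtain ⟨L, hL, -, hb⟩ := exists_hasFDerivAt_freeWave h t x
  rwa [hL.fderiv]

lemma hasDerivAt_freeWave (h : 𝓢(Euc n, ℂ)) (t : ℝ) (x : Euc n) :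
    HasDerivAt (fun s => freeWave h s x) (freeWave (freeGenerator h) t x) t := by
  refine (hasDerivAt_integral_of_dominated_loc_of_deriv_le (𝕜 := ℝ) (μ := volume)
    (F := fun s (η : Euc n) => Complex.exp (I * ((⟪x, η⟫_ℝ - s * ‖η‖ ^ 2 / 2 : ℝ) : ℂ)) * h η)
    (F' := fun s (η : Euc n) =>
      Complex.exp (I * ((⟪x, η⟫_ℝ - s * ‖η‖ ^ 2 / 2 : ℝ) : ℂ)) * freeGenerator h η)
    (x₀ := t) (s := Set.univ) (bound := fun η => ‖freeGenerator h η‖)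
    Filter.univ_mem (.of_forall fun s => (integrable_freeWave h s x).aestronglyMeasurable)
    (integrable_freeWave h t x) (integrable_freeWave _ t x).aestronglyMeasurable
    (.of_forall fun η s _ => (norm_exp_I_mul_real_mul _ _).le)
    (freeGenerator h).integrable.norm (.of_forall fun η s _ => ?_)).2
  have h1 : HasDerivAt (fun s : ℝ => ⟪x, η⟫_ℝ - s * ‖η‖ ^ 2 / 2) (-(‖η‖ ^ 2 / 2)) s := by
    simpa [mul_div_assoc] using ((hasDerivAt_id s).mul_const (‖η‖ ^ 2 / 2)).const_sub ⟪x, η⟫_ℝ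
  have h2 := (h1.ofReal_comp.const_mul I).cexp.mul_const (h η)
  refine h2.congr_deriv ?_
  rw [freeGenerator_apply]
  push_cast
  ring

/-- The free evolution of a Schwartz function is a superposition of free plane waves with
Schwartz amplitude. -/
lemma exists_U0_eq_freeWave (φ₀ : 𝓢(Euc n, ℂ)) :
    ∃ g : 𝓢(Euc n, ℂ), ∀ t, U0 t ⇑φ₀ = freeWave g t := by
  have hpi : ((2 * Real.pi)⁻¹ : ℝ) ≠ 0 := by positivity
  let A : Euc n ≃L[ℝ] Euc n := ContinuousLinearEquiv.smulLeft (Units.mk0 _ hpi)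
  let G : 𝓢(Euc n, ℂ) := SchwartzMap.compCLMOfContinuousLinearEquiv ℂ A (𝓕 φ₀)
  have hG : ∀ η, FT ⇑φ₀ η = G η := by
    intro η
    change _ = 𝓕 φ₀ ((2 * Real.pi)⁻¹ • η)
    rw [SchwartzMap.fourier_coe, Real.fourier_eq', FT]
    congr 1 with y
    rw [smul_eq_mul, real_inner_smul_right]
    congr 2
    have : (Real.pi : ℂ) ≠ 0 := by exact_mod_cast Real.pi_ne_zero
    push_cast
    field_simp
  refine ⟨(((((2 * Real.pi) ^ n)⁻¹ : ℝ) : ℂ)) • G, fun t => funext fun x => ?_⟩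
  rw [freeWave_smul, U0, real_smul]
  simp only [hG, freeWave]

lemma continuous_freeWave (h : 𝓢(Euc n, ℂ)) (t : ℝ) : Continuous (freeWave h t) :=
  (differentiable_freeWave h t).continuous

lemma norm_WPT_integrand (a b : ℂ) (r : ℝ) :
    ‖(starRingEnd ℂ) a * b * Complex.exp (-I * (r : ℂ))‖ = ‖a‖ * ‖b‖ := by
  rw [norm_mul, norm_exp_neg_I_mul_real, mul_one, norm_mul, RCLike.norm_conj]

lemma integrable_WPT_freeWave (h f : 𝓢(Euc n, ℂ)) (t : ℝ) (x ξ : Euc n) :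
    Integrable fun y : Euc n => (starRingEnd ℂ) (freeWave h t (y - x)) * f y *
      Complex.exp (-I * ((⟪y, ξ⟫_ℝ : ℝ) : ℂ)) := by
  refine (f.integrable.norm.const_mul (∫ η, ‖h η‖)).mono' ?_ (.of_forall fun y => ?_)
  · have := f.continuous
    have := continuous_freeWave h t
    exact Continuous.aestronglyMeasurable (by fun_prop)
  · rw [norm_WPT_integrand]
    gcongr
    exact norm_freeWave_le h t _

/-- The wave packet transform with a free wave as window, as a linear map on Schwartz functions. -/
def freeWavePacket (h : 𝓢(Euc n, ℂ)) (t : ℝ) (x ξ : Euc n) : 𝓢(Euc n, ℂ) →ₗ[ℂ] ℂ where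
  toFun f := WPT (freeWave h t) f x ξ
  map_add' f₁ f₂ := by
    rw [WPT, WPT, WPT, ← integral_add (integrable_WPT_freeWave h f₁ t x ξ)
      (integrable_WPT_freeWave h f₂ t x ξ)]
    congr 1 with y
    rw [add_apply]
    ring
  map_smul' c f := by
    rw [WPT, WPT, RingHom.id_apply, smul_eq_mul, ← integral_const_mul]
    congr 1 with y
    rw [smul_apply, smul_eq_mul]
    ring

lemma freeWavePacket_apply (h f : 𝓢(Euc n, ℂ)) (t : ℝ) (x ξ : Euc n) :
    freeWavePacket h t x ξ f = WPT (freeWave h t) f x ξ := rfl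

lemma freeWavePacket_smul_left (c : ℂ) (h f : 𝓢(Euc n, ℂ)) (t : ℝ) (x ξ : Euc n) :
    freeWavePacket (c • h) t x ξ f = (starRingEnd ℂ) c * freeWavePacket h t x ξ f := by
  rw [freeWavePacket_apply, freeWavePacket_apply, WPT, WPT, ← integral_const_mul]
  congr 1 with y
  rw [freeWave_smul, map_mul]
  ring

lemma freeWavePacket_sum_left {ι : Type*} (s : Finset ι) (h : ι → 𝓢(Euc n, ℂ))
    (f : 𝓢(Euc n, ℂ)) (t : ℝ) (x ξ : Euc n) :
    freeWavePacket (∑ i ∈ s, h i) t x ξ f = ∑ i ∈ s, freeWavePacket (h i) t x ξ f := by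
  simp only [freeWavePacket_apply, WPT]
  rw [← integral_finsetSum s fun i _ => integrable_WPT_freeWave (h i) f t x ξ]
  congr 1 with y
  rw [freeWave_sum, map_sum, Finset.sum_mul, Finset.sum_mul]

lemma hasFDerivAt_exp_neg_I_inner (ξ y : Euc n) :
    HasFDerivAt (fun y : Euc n => Complex.exp (-I * ((⟪y, ξ⟫_ℝ : ℝ) : ℂ)))
      ((Complex.exp (-I * ((⟪y, ξ⟫_ℝ : ℝ) : ℂ)) * -I) • (ofRealCLM ∘L innerSL ℝ ξ)) y := by
  have h1 : HasFDerivAt (fun y : Euc n => ⟪y, ξ⟫_ℝ) (innerSL ℝ ξ) y := by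
    simpa [real_inner_comm] using (innerSL ℝ ξ).hasFDerivAt (x := y)
  have h2 := ((ofRealCLM.hasFDerivAt.comp y h1).const_mul (-I)).cexp
  refine h2.congr_fderiv ?_
  rw [smul_smul]
  rfl

lemma hasFDerivAt_conj_freeWave (h : 𝓢(Euc n, ℂ)) (t : ℝ) (x : Euc n) :
    HasFDerivAt (fun z => (starRingEnd ℂ) (freeWave h t z))
      ((conjCLE : ℂ →L[ℝ] ℂ) ∘L fderiv ℝ (freeWave h t) x) x :=
  (conjCLE : ℂ →L[ℝ] ℂ).hasFDerivAt.comp x (differentiable_freeWave h t x).hasFDerivAt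

/-- Integration by parts in the wave packet transform. -/
lemma freeWavePacket_lineDeriv (h f : 𝓢(Euc n, ℂ)) (t : ℝ) (x ξ v : Euc n) :
    freeWavePacket h t x ξ (∂_{v} f) =
      -freeWavePacket (mulInner v h) t x ξ f + I * ((⟪v, ξ⟫_ℝ : ℝ) : ℂ) *
        freeWavePacket h t x ξ f := by
  let w : Euc n → ℂ := fun y =>
    (starRingEnd ℂ) (freeWave h t (y - x)) * Complex.exp (-I * ((⟪y, ξ⟫_ℝ : ℝ) : ℂ))
  have hw : ∀ y, HasFDerivAt w _ y := fun y =>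
    ((hasFDerivAt_conj_freeWave h t (y - x)).comp y ((hasFDerivAt_id y).sub_const x)).mul
      (hasFDerivAt_exp_neg_I_inner ξ y)
  have hw' : ∀ y, fderiv ℝ w y v * f y =
      (starRingEnd ℂ) (freeWave (mulInner v h) t (y - x)) * f y *
          Complex.exp (-I * ((⟪y, ξ⟫_ℝ : ℝ) : ℂ)) -
        I * ((⟪v, ξ⟫_ℝ : ℝ) : ℂ) * ((starRingEnd ℂ) (freeWave h t (y - x)) * f y *
          Complex.exp (-I * ((⟪y, ξ⟫_ℝ : ℝ) : ℂ))) := by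
    intro y
    rw [(hw y).fderiv]
    simp [fderiv_freeWave, real_inner_comm]
    ring
  have hi := integrable_WPT_freeWave h f t x ξ
  have hi' := integrable_WPT_freeWave (mulInner v h) f t x ξ
  have hd := integrable_WPT_freeWave h (∂_{v} f) t x ξ
  have key := integral_mul_fderiv_eq_neg_fderiv_mul_of_integrable (μ := volume) (f := w) (g := f)
    (v := v) (by simp only [hw']; exact hi'.sub (hi.const_mul _))
    (hd.congr (.of_forall fun y => by
      simp only [w, SchwartzMap.lineDerivOp_apply_eq_fderiv]; ring))
    (hi.congr (.of_forall fun y => by simp only [w]; ring))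
    (fun y _ => (hw y).differentiableAt) (fun y _ => f.differentiableAt)
  simp only [hw'] at key
  rw [integral_sub hi' (hi.const_mul _), integral_const_mul] at key
  simp only [freeWavePacket_apply, WPT]
  have hL : ∫ y, (starRingEnd ℂ) (freeWave h t (y - x)) * (∂_{v} f) y *
      Complex.exp (-I * ((⟪y, ξ⟫_ℝ : ℝ) : ℂ)) = ∫ y, w y * fderiv ℝ f y v := by
    congr 1 with y
    simp only [w, SchwartzMap.lineDerivOp_apply_eq_fderiv]
    ring
  linear_combination hL + key

lemma fderiv_WPT_position (h f : 𝓢(Euc n, ℂ)) (t : ℝ) (x ξ v : Euc n) :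
    fderiv ℝ (fun z => WPT (freeWave h t) f z ξ) x v = -freeWavePacket (mulInner v h) t x ξ f := by
  let E : Euc n → Euc n → ℂ := fun z y =>
    (starRingEnd ℂ) (freeWave h t (y - z)) * f y * Complex.exp (-I * ((⟪y, ξ⟫_ℝ : ℝ) : ℂ))
  let E' : Euc n → Euc n → Euc n →L[ℝ] ℂ := fun z y =>
    -((f y * Complex.exp (-I * ((⟪y, ξ⟫_ℝ : ℝ) : ℂ))) •
      ((conjCLE : ℂ →L[ℝ] ℂ) ∘L fderiv ℝ (freeWave h t) (y - z)))
  have hE' : ∀ z y, ‖E' z y‖ ≤ (∫ η, ‖η‖ * ‖h η‖) * ‖f y‖ := by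
    intro z y
    have hC : 0 ≤ ∫ η, ‖η‖ * ‖h η‖ := integral_nonneg fun η => by positivity
    refine ContinuousLinearMap.opNorm_le_bound _ (by positivity) fun v => ?_
    have h1 : ‖fderiv ℝ (freeWave h t) (y - z) v‖ ≤ (∫ η, ‖η‖ * ‖h η‖) * ‖v‖ :=
      ContinuousLinearMap.le_of_opNorm_le _ (norm_fderiv_freeWave_le h t _) v
    have h2 : ‖E' z y v‖ = ‖f y‖ * ‖fderiv ℝ (freeWave h t) (y - z) v‖ := by
      have := norm_exp_neg_I_mul_real ⟪y, ξ⟫_ℝ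
      simp only [E', neg_apply, smul_apply, norm_neg, norm_smul, norm_mul, this, mul_one]
      simp
    rw [h2]
    nlinarith [norm_nonneg (f y)]
  have hbi := f.integrable (μ := volume) |>.norm.const_mul (∫ η, ‖η‖ * ‖h η‖)
  have hmeas : AEStronglyMeasurable (E' x) volume := by
    have h1 : Measurable fun y => fderiv ℝ (freeWave h t) (y - x) :=
      (measurable_fderiv ℝ (freeWave h t)).comp (measurable_id.sub_const x)
    have h2 : AEStronglyMeasurable
        (fun y => (conjCLE : ℂ →L[ℝ] ℂ) ∘L fderiv ℝ (freeWave h t) (y - x)) volume :=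
      (ContinuousLinearMap.compL ℝ (Euc n) ℂ ℂ
        (conjCLE : ℂ →L[ℝ] ℂ)).continuous.comp_aestronglyMeasurable h1.aestronglyMeasurable
    have := f.continuous
    have h3 : Continuous fun y : Euc n => f y * Complex.exp (-I * ((⟪y, ξ⟫_ℝ : ℝ) : ℂ)) := by
      fun_prop
    exact (h3.aestronglyMeasurable.smul h2).neg
  have hderiv := hasFDerivAt_integral_of_dominated_of_fderiv_le (𝕜 := ℝ) (μ := volume)
    (F := E) (F' := E') (x₀ := x) (s := Set.univ)
    Filter.univ_mem (.of_forall fun z => (integrable_WPT_freeWave h f t z ξ).aestronglyMeasurable)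
    (integrable_WPT_freeWave h f t x ξ) hmeas (.of_forall fun y z _ => hE' z y) hbi
    (.of_forall fun y z _ => by
      have h1 := (((hasFDerivAt_conj_freeWave h t (y - z)).comp z
        ((hasFDerivAt_id z).const_sub y)).mul_const (f y)).mul_const
          (Complex.exp (-I * ((⟪y, ξ⟫_ℝ : ℝ) : ℂ)))
      refine h1.congr_fderiv ?_
      ext v
      simp [E']
      ring)
  have hF : HasFDerivAt (fun z => WPT (freeWave h t) f z ξ) (∫ y, E' x y) x := hderiv
  rw [hF.fderiv, ContinuousLinearMap.integral_apply (hbi.mono' hmeas (.of_forall (hE' x))),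
    freeWavePacket_apply, WPT, ← integral_neg]
  congr 1 with y
  simp [E', fderiv_freeWave]
  ring

lemma fderiv_WPT_frequency (h f : 𝓢(Euc n, ℂ)) (t : ℝ) (x ξ v : Euc n) :
    fderiv ℝ (fun η => WPT (freeWave h t) f x η) ξ v =
      -freeWavePacket h t x ξ (mulInner v f) := by
  let E : Euc n → Euc n → ℂ := fun η y =>
    (starRingEnd ℂ) (freeWave h t (y - x)) * f y * Complex.exp (-I * ((⟪y, η⟫_ℝ : ℝ) : ℂ))
  let E' : Euc n → Euc n → Euc n →L[ℝ] ℂ := fun η y =>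
    (E η y * -I) • (ofRealCLM ∘L innerSL ℝ y)
  have hE' : ∀ η y, ‖E' η y‖ ≤ (∫ η, ‖h η‖) * (‖y‖ * ‖f y‖) := by
    intro η y
    have hC : 0 ≤ ∫ η, ‖h η‖ := integral_nonneg fun η => by positivity
    refine ContinuousLinearMap.opNorm_le_bound _ (by positivity) fun v => ?_
    have h2 : ‖E' η y v‖ = ‖freeWave h t (y - x)‖ * ‖f y‖ * ‖⟪y, v⟫_ℝ‖ := by
      have := norm_WPT_integrand (freeWave h t (y - x)) (f y) ⟪y, η⟫_ℝ
      simp only [E', E, smul_apply, norm_smul, norm_mul, norm_neg, norm_I, mul_one] at this ⊢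
      rw [this]
      simp
    rw [h2]
    calc _ ≤ (∫ η, ‖h η‖) * ‖f y‖ * (‖y‖ * ‖v‖) := by
          gcongr
          · exact norm_freeWave_le h t _
          · exact norm_inner_le_norm y v
      _ = _ := by ring
  have hbi : Integrable fun y : Euc n => (∫ η, ‖h η‖) * (‖y‖ * ‖f y‖) :=
    Integrable.const_mul (by simpa using f.integrable_pow_mul volume 1) _
  have hmeas : AEStronglyMeasurable (E' ξ) volume := by
    have := f.continuous
    have := continuous_freeWave h t
    have h1 : Continuous fun y : Euc n => ofRealCLM ∘L innerSL ℝ y :=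
      (ContinuousLinearMap.compL ℝ (Euc n) ℝ ℂ ofRealCLM).continuous.comp (innerSL ℝ).continuous
    have h2 : Continuous fun y : Euc n => E ξ y * -I := by fun_prop
    exact (h2.smul h1).aestronglyMeasurable
  have hderiv := hasFDerivAt_integral_of_dominated_of_fderiv_le (𝕜 := ℝ) (μ := volume)
    (F := E) (F' := E') (x₀ := ξ) (s := Set.univ)
    Filter.univ_mem (.of_forall fun η => (integrable_WPT_freeWave h f t x η).aestronglyMeasurable)
    (integrable_WPT_freeWave h f t x ξ) hmeas (.of_forall fun y η _ => hE' η y) hbi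
    (.of_forall fun y η _ => by
      have h1 := (hasFDerivAt_exp_neg_I_inner y η).const_mul
        ((starRingEnd ℂ) (freeWave h t (y - x)) * f y)
      simp only [real_inner_comm] at h1
      refine h1.congr_fderiv ?_
      ext v
      simp [E', E]
      ring)
  have hF : HasFDerivAt (fun η => WPT (freeWave h t) f x η) (∫ y, E' ξ y) ξ := hderiv
  rw [hF.fderiv, ContinuousLinearMap.integral_apply (hbi.mono' hmeas (.of_forall (hE' ξ))),
    freeWavePacket_apply, WPT, ← integral_neg]
  congr 1 with y
  simp [E', E, mulInner_apply, real_inner_comm]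
  ring

/-- A continuous curve of Schwartz functions is locally uniformly dominated by an integrable
function. -/
lemma exists_integrable_bound_schwartz {S : ℝ → 𝓢(Euc n, ℂ)} (hS : Continuous S) (t : ℝ) :
    ∃ b : Euc n → ℝ, Integrable b ∧ ∀ s ∈ Metric.closedBall t 1, ∀ y, ‖S s y‖ ≤ b y := by
  let p : Seminorm ℝ 𝓢(Euc n, ℂ) :=
    (Finset.Iic ((n + 1, 0) : ℕ × ℕ)).sup fun m => SchwartzMap.seminorm ℝ m.1 m.2
  have hp : Continuous p := Seminorm.continuous_finsetSup fun m _ =>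
    (schwartz_withSeminorms ℝ (Euc n) ℂ).continuous_seminorm m
  obtain ⟨C, hC⟩ := (isCompact_closedBall t 1).exists_bound_of_continuousOn
    (hp.comp hS).continuousOn
  refine ⟨fun y => 2 ^ (n + 1) * C * (1 + ‖y‖) ^ (-((n : ℝ) + 1)), ?_, fun s hs y => ?_⟩
  · exact (integrable_one_add_norm (by simp)).const_mul _
  · have h1 := SchwartzMap.one_add_le_sup_seminorm_apply (𝕜 := ℝ) (m := (n + 1, 0))
      le_rfl le_rfl (S s) y
    have h2 : p (S s) ≤ C := (le_abs_self _).trans (hC s hs)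
    rw [norm_iteratedFDeriv_zero] at h1
    have hpos : 0 < (1 + ‖y‖) ^ (n + 1) := by positivity
    have h3 : (1 + ‖y‖) ^ (-((n : ℝ) + 1)) = ((1 + ‖y‖) ^ (n + 1))⁻¹ := by
      rw [Real.rpow_neg (by positivity)]
      norm_cast
    beta_reduce
    rw [h3, ← div_eq_mul_inv, le_div_iff₀ hpos, mul_comm]
    exact h1.trans (by gcongr)

lemma hasDerivAt_WPT_time (h : 𝓢(Euc n, ℂ)) {S S' : ℝ → 𝓢(Euc n, ℂ)} (hS : Continuous S)
    (hS' : Continuous S') (hderiv : ∀ t y, HasDerivAt (fun s => S s y) (S' t y) t)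
    (t : ℝ) (x ξ : Euc n) :
    HasDerivAt (fun s => WPT (freeWave h s) (S s) x ξ)
      (freeWavePacket (freeGenerator h) t x ξ (S t) + freeWavePacket h t x ξ (S' t)) t := by
  obtain ⟨b, hb, hSb⟩ := exists_integrable_bound_schwartz hS t
  obtain ⟨b', hb', hSb'⟩ := exists_integrable_bound_schwartz hS' t
  have hi := integrable_WPT_freeWave (freeGenerator h) (S t) t x ξ
  have hi' := integrable_WPT_freeWave h (S' t) t x ξ
  rw [freeWavePacket_apply, freeWavePacket_apply, WPT, WPT, ← integral_add hi hi']
  refine (hasDerivAt_integral_of_dominated_loc_of_deriv_le (𝕜 := ℝ) (μ := volume)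
    (F := fun s (y : Euc n) => (starRingEnd ℂ) (freeWave h s (y - x)) * S s y *
      Complex.exp (-I * ((⟪y, ξ⟫_ℝ : ℝ) : ℂ)))
    (F' := fun s (y : Euc n) => (starRingEnd ℂ) (freeWave (freeGenerator h) s (y - x)) * S s y *
        Complex.exp (-I * ((⟪y, ξ⟫_ℝ : ℝ) : ℂ)) +
      (starRingEnd ℂ) (freeWave h s (y - x)) * S' s y *
        Complex.exp (-I * ((⟪y, ξ⟫_ℝ : ℝ) : ℂ)))
    (bound := fun y => (∫ η, ‖freeGenerator h η‖) * b y + (∫ η, ‖h η‖) * b' y)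
    (x₀ := t) (s := Metric.closedBall t 1) (Metric.closedBall_mem_nhds t one_pos)
    (.of_forall fun s => (integrable_WPT_freeWave h (S s) s x ξ).aestronglyMeasurable)
    (integrable_WPT_freeWave h (S t) t x ξ) (hi.add hi').aestronglyMeasurable
    (.of_forall fun y s hs => ?_) ((hb.const_mul _).add (hb'.const_mul _))
    (.of_forall fun y s _ => ?_)).2
  · refine (norm_add_le _ _).trans ?_
    rw [norm_WPT_integrand, norm_WPT_integrand]
    have h1 : 0 ≤ ∫ η, ‖freeGenerator h η‖ := integral_nonneg fun η => norm_nonneg _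
    have h2 : 0 ≤ ∫ η, ‖h η‖ := integral_nonneg fun η => norm_nonneg _
    gcongr
    · exact norm_freeWave_le _ _ _
    · exact hSb s hs y
    · exact norm_freeWave_le _ _ _
    · exact hSb' s hs y
  · have h1 := (conjCLE : ℂ →L[ℝ] ℂ).hasFDerivAt.comp_hasDerivAt s
      (hasDerivAt_freeWave h s (y - x))
    refine ((h1.mul (hderiv s y)).mul_const
      (Complex.exp (-I * ((⟪y, ξ⟫_ℝ : ℝ) : ℂ)))).congr_deriv ?_
    simp only [ContinuousLinearEquiv.coe_coe, conjCLE_apply, Function.comp_apply]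
    ring

lemma lapl_schwartz (f : 𝓢(Euc n, ℂ)) (y : Euc n) :
    lapl f y = (∑ j : Fin n, ∂_{EuclideanSpace.single j (1 : ℝ)}
      (∂_{EuclideanSpace.single j (1 : ℝ)} f)) y := by
  rw [sum_apply]
  rfl

lemma mulInner_eq_sum (v : Euc n) (h : 𝓢(Euc n, ℂ)) :
    mulInner v h = ∑ j : Fin n, ((v j : ℝ) : ℂ) • mulInner (EuclideanSpace.single j 1) h := by
  ext η
  simp only [sum_apply, smul_apply, mulInner_apply, EuclideanSpace.inner_single_left, map_one,
    one_mul, smul_eq_mul]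
  rw [PiLp.inner_apply]
  push_cast
  rw [Finset.mul_sum, Finset.sum_mul]
  refine Finset.sum_congr rfl fun j _ => ?_
  simp
  ring

/-- The Laplacian is transferred from the function to the window of the wave packet transform. -/
lemma freeWavePacket_laplacian (h f : 𝓢(Euc n, ℂ)) (t : ℝ) (x ξ : Euc n) :
    freeWavePacket h t x ξ (∑ j : Fin n, ∂_{EuclideanSpace.single j (1 : ℝ)}
      (∂_{EuclideanSpace.single j (1 : ℝ)} f)) =
    2 * I * freeWavePacket (freeGenerator h) t x ξ f
      - 2 * I * freeWavePacket (mulInner ξ h) t x ξ f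
      - ((‖ξ‖ ^ 2 : ℝ) : ℂ) * freeWavePacket h t x ξ f := by
  have hI : ∀ a : ℂ, 2 * I * ((starRingEnd ℂ) (I / 2) * a) = a := by
    intro a
    simp only [map_div₀, conj_I, map_ofNat]
    linear_combination -a * I_sq
  rw [map_sum, mulInner_eq_sum, freeGenerator, freeWavePacket_smul_left, freeWavePacket_sum_left,
    freeWavePacket_sum_left, hI, ofReal_norm_sq_eq_sum, Finset.mul_sum, Finset.sum_mul,
    ← Finset.sum_sub_distrib, ← Finset.sum_sub_distrib]
  refine Finset.sum_congr rfl fun j _ => ?_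
  simp only [freeWavePacket_lineDeriv, freeWavePacket_smul_left, conj_ofReal,
    EuclideanSpace.inner_single_left, map_one, one_mul]
  linear_combination ((ξ j : ℝ) : ℂ) ^ 2 * freeWavePacket h t x ξ f * I_sq

/-- The wave packet transform `F(t,x,ξ)` of a Schwartz-class solution
of the Schrödinger equation satisfies the transport equation with remainder `R`. -/
theorem wavePacket_transport_equation (hn : 1 ≤ n) (V : ℝ × Euc n → ℝ) (ρ : ℝ)
    (hρ0 : 0 ≤ ρ) (hρ2 : ρ < 2) (hV : SubQuadratic ρ V)
    (u : ℝ → Euc n → ℂ)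
    (hu_smooth : ContDiff ℝ (⊤ : ℕ∞) fun p : ℝ × Euc n => u p.1 p.2)
    (Us : ℝ → SchwartzMap (Euc n) ℂ) (hUs : ∀ t : ℝ, (⇑(Us t) : Euc n → ℂ) = u t)
    (hUscont : Continuous Us)
    (Us' : ℝ → SchwartzMap (Euc n) ℂ) (hUs'cont : Continuous Us')
    (hUs'deriv : ∀ (t : ℝ) (x : Euc n), HasDerivAt (fun s => u s x) (Us' t x) t)
    (hPDE : ∀ (t : ℝ) (x : Euc n),
      Complex.I * deriv (fun s => u s x) t + (1 / 2 : ℂ) * lapl (u t) x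
        - ((V (t, x) : ℝ) : ℂ) * u t x = 0)
    (φ₀ : SchwartzMap (Euc n) ℂ)
    (F : ℝ → Euc n → Euc n → ℂ)
    (hF : ∀ (t : ℝ) (x ξ : Euc n), F t x ξ = WPT (U0 t ⇑φ₀) (u t) x ξ)
    (t : ℝ) (x ξ : Euc n) :
    Complex.I * deriv (fun s => F s x ξ) t
      + Complex.I * fderiv ℝ (fun z => F t z ξ) x ξ
      - Complex.I * fderiv ℝ (fun η => F t x η) ξ (gradV V t x)
      - ((‖ξ‖ ^ 2 / 2 + V (t, x) - ⟪x, gradV V t x⟫_ℝ : ℝ) : ℂ) * F t x ξ =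
    ∫ y, (starRingEnd ℂ) (U0 t ⇑φ₀ (y - x)) *
      ((V (t, y) - V (t, x) - ⟪gradV V t x, y - x⟫_ℝ : ℝ) : ℂ) * u t y *
        Complex.exp (-Complex.I * ((⟪y, ξ⟫_ℝ : ℝ) : ℂ)) := by
  obtain ⟨g, hg⟩ := exists_U0_eq_freeWave φ₀
  set a := gradV V t x
  have hu : ∀ s, u s = ⇑(Us s) := fun s => (hUs s).symm
  have hF' : ∀ s z η, F s z η = WPT (freeWave g s) (Us s) z η := fun s z η => by
    rw [hF, hg, hu]
  have hdt := (hasDerivAt_WPT_time g hUscont hUs'cont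
    (fun s y => by simpa only [hu] using hUs'deriv s y) t x ξ).deriv
  let L : 𝓢(Euc n, ℂ) := ∑ j : Fin n, ∂_{EuclideanSpace.single j (1 : ℝ)}
    (∂_{EuclideanSpace.single j (1 : ℝ)} (Us t))
  have hVu : ∀ y, ((V (t, y) : ℝ) : ℂ) * Us t y = (I • Us' t + (1 / 2 : ℂ) • L) y := by
    intro y
    have h1 := hPDE t y
    rw [(hUs'deriv t y).deriv, hu, lapl_schwartz] at h1
    simp only [add_apply, smul_apply, smul_eq_mul]
    linear_combination -h1
  have hR : ∫ y, (starRingEnd ℂ) (U0 t ⇑φ₀ (y - x)) *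
      ((V (t, y) - V (t, x) - ⟪a, y - x⟫_ℝ : ℝ) : ℂ) * u t y *
        Complex.exp (-I * ((⟪y, ξ⟫_ℝ : ℝ) : ℂ)) =
      freeWavePacket g t x ξ (I • Us' t + (1 / 2 : ℂ) • L
        - ((V (t, x) - ⟪x, a⟫_ℝ : ℝ) : ℂ) • Us t + I • mulInner a (Us t)) := by
    rw [freeWavePacket_apply, WPT]
    congr 1 with y
    rw [add_apply, sub_apply, ← hVu, smul_apply, smul_apply, mulInner_apply, hg, hu,
      inner_sub_right, real_inner_comm a x]
    simp only [smul_eq_mul]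
    push_cast
    linear_combination -(starRingEnd ℂ) (freeWave g t (y - x)) * ((⟪a, y⟫_ℝ : ℝ) : ℂ) * Us t y *
      Complex.exp (-I * ((⟪y, ξ⟫_ℝ : ℝ) : ℂ)) * I_sq
  rw [hR]
  simp only [hF', hdt, fderiv_WPT_position, fderiv_WPT_frequency, map_add, map_sub, map_smul,
    smul_eq_mul]
  rw [freeWavePacket_laplacian, ← freeWavePacket_apply]
  push_cast
  ring

end
end
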